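/- arXiv:2510.22678 — 13 statements merged into one kernel-verified Lean document; each statement's English description precedes it below -/
import Mathlib

section
/- Let ‖·‖ be a nonarchimedean ring seminorm on a commutative ring A, and for f ∈ A let |f|_sp = inf_{n ≥ 1} ‖f^n‖^{1/n} denote its spectral seminorm. Then for every real number r > 0 and every f ∈ A: (1) the sequence (‖f^n‖/r^n)_n converges to 0 if and only if |f|_sp < r; (2) if the sequence (‖f^n‖/r^n)_n is bounded, then |f|_sp ≤ r; (3) if moreover there exists a constant C > 0 with ‖g‖ ≤ C·|g|_sp for all g ∈ A (i.e. A is uniform), then the sequence (‖f^n‖/r^n)_n is bounded if and only if |f|_sp ≤ r. -/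
open Filter Topology

/-- The spectral seminorm associated to a ring seminorm:
`|f|_sp = inf_{n ≥ 1} ‖f^n‖^(1/n)`. -/
noncomputable def spectralSeminorm {A : Type*} [CommRing A] (nrm : A → ℝ) (f : A) : ℝ :=
  ⨅ n : ℕ+, (nrm (f ^ (n : ℕ))) ^ (((n : ℕ) : ℝ)⁻¹)

section SpectralSeminorm

variable {A : Type*} [CommRing A] {nrm : A → ℝ}

theorem spectralSeminorm_le_rpow (h_nonneg : ∀ a, 0 ≤ nrm a) (f : A) (n : ℕ+) :
    spectralSeminorm nrm f ≤ nrm (f ^ (n : ℕ)) ^ (((n : ℕ) : ℝ)⁻¹) :=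
  ciInf_le ⟨0, by rintro _ ⟨m, rfl⟩; exact Real.rpow_nonneg (h_nonneg _) _⟩ n

theorem spectralSeminorm_le_of_pow_le (h_nonneg : ∀ a, 0 ≤ nrm a) {f : A} {s : ℝ} (hs : 0 ≤ s)
    {n : ℕ} (hn : n ≠ 0) (h : nrm (f ^ n) ≤ s ^ n) : spectralSeminorm nrm f ≤ s :=
  calc spectralSeminorm nrm f ≤ nrm (f ^ n) ^ ((n : ℝ)⁻¹) :=
        spectralSeminorm_le_rpow h_nonneg f ⟨n, Nat.pos_of_ne_zero hn⟩
    _ ≤ (s ^ n) ^ ((n : ℝ)⁻¹) := Real.rpow_le_rpow (h_nonneg _) h (by positivity)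
    _ = s := Real.pow_rpow_inv_natCast hs hn

theorem spectralSeminorm_lt_iff (h_nonneg : ∀ a, 0 ≤ nrm a) {f : A} {s : ℝ} (hs : 0 ≤ s) :
    spectralSeminorm nrm f < s ↔ ∃ n : ℕ, n ≠ 0 ∧ nrm (f ^ n) < s ^ n := by
  constructor
  · intro h
    obtain ⟨n, hn⟩ := exists_lt_of_ciInf_lt h
    refine ⟨n, n.ne_zero, ?_⟩
    calc nrm (f ^ (n : ℕ)) = (nrm (f ^ (n : ℕ)) ^ (((n : ℕ) : ℝ)⁻¹)) ^ (n : ℕ) :=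
          (Real.rpow_inv_natCast_pow (h_nonneg _) n.ne_zero).symm
      _ < s ^ (n : ℕ) := pow_lt_pow_left₀ hn (Real.rpow_nonneg (h_nonneg _) _) n.ne_zero
  · rintro ⟨n, hn, h⟩
    calc spectralSeminorm nrm f ≤ nrm (f ^ n) ^ ((n : ℝ)⁻¹) :=
          spectralSeminorm_le_rpow h_nonneg f ⟨n, Nat.pos_of_ne_zero hn⟩
      _ < (s ^ n) ^ ((n : ℝ)⁻¹) := Real.rpow_lt_rpow (h_nonneg _) h (by positivity)
      _ = s := Real.pow_rpow_inv_natCast hs hn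

theorem nrm_pow_le_pow (h_nonneg : ∀ a, 0 ≤ nrm a) (h_one : nrm 1 = 1)
    (h_mul : ∀ a b, nrm (a * b) ≤ nrm a * nrm b) (a : A) (n : ℕ) :
    nrm (a ^ n) ≤ nrm a ^ n := by
  induction n with
  | zero => simp [h_one]
  | succ n ih =>
    rw [pow_succ, pow_succ]
    exact (h_mul _ _).trans (mul_le_mul_of_nonneg_right ih (h_nonneg a))

theorem tendsto_nrm_pow_div_pow_iff (h_nonneg : ∀ a, 0 ≤ nrm a) (h_one : nrm 1 = 1)
    (h_mul : ∀ a b, nrm (a * b) ≤ nrm a * nrm b) {r : ℝ} (hr : 0 < r) (f : A) :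
    Tendsto (fun n : ℕ => nrm (f ^ n) / r ^ n) atTop (𝓝 0) ↔ spectralSeminorm nrm f < r := by
  rw [spectralSeminorm_lt_iff h_nonneg hr.le]
  constructor
  · intro h
    obtain ⟨n, hn, hn0⟩ := ((h.eventually_lt_const one_pos).and (eventually_ne_atTop 0)).exists
    exact ⟨n, hn0, (div_lt_one (pow_pos hr n)).1 hn⟩
  · rintro ⟨N, hN, h⟩
    set u : ℕ → ℝ := fun n => nrm (f ^ n) / r ^ n
    have hu : ∀ n, 0 ≤ u n := fun n => div_nonneg (h_nonneg _) (pow_pos hr n).le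
    have hq : u N < 1 := (div_lt_one (pow_pos hr N)).2 h
    have hbound : ∀ n, u n ≤ u N ^ (n / N) * ∑ j ∈ Finset.range N, u j := by
      intro n
      have hsplit : u n ≤ u N ^ (n / N) * u (n % N) := by
        have hle : nrm (f ^ n) ≤ nrm (f ^ N) ^ (n / N) * nrm (f ^ (n % N)) := by
          conv_lhs => rw [← Nat.div_add_mod n N, pow_add, pow_mul]
          exact (h_mul _ _).trans (mul_le_mul_of_nonneg_right
            (nrm_pow_le_pow h_nonneg h_one h_mul _ _) (h_nonneg _))
        have hpow : r ^ n = (r ^ N) ^ (n / N) * r ^ (n % N) := by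
          rw [← pow_mul, ← pow_add, Nat.div_add_mod]
        simp only [u]
        rw [hpow, div_pow, div_mul_div_comm]
        gcongr
      exact hsplit.trans (mul_le_mul_of_nonneg_left
        (Finset.single_le_sum (fun j _ => hu j)
          (Finset.mem_range.2 (Nat.mod_lt n (Nat.pos_of_ne_zero hN))))
        (pow_nonneg (hu N) _))
    have hlim : Tendsto (fun n => u N ^ (n / N) * ∑ j ∈ Finset.range N, u j) atTop (𝓝 0) := by
      simpa using ((tendsto_pow_atTop_nhds_zero_of_lt_one (hu N) hq).comp
        (Nat.tendsto_div_const_atTop hN)).mul_const (∑ j ∈ Finset.range N, u j)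
    exact squeeze_zero hu hbound hlim

theorem spectralSeminorm_le_of_bounded (h_nonneg : ∀ a, 0 ≤ nrm a) (h_one : nrm 1 = 1)
    (h_mul : ∀ a b, nrm (a * b) ≤ nrm a * nrm b) {r : ℝ} (hr : 0 < r) {f : A} {C : ℝ}
    (hC : ∀ n : ℕ, nrm (f ^ n) / r ^ n ≤ C) : spectralSeminorm nrm f ≤ r := by
  refine le_of_forall_gt_imp_ge_of_dense fun s hs => le_of_lt ?_
  have hs0 : 0 < s := hr.trans hs
  rw [← tendsto_nrm_pow_div_pow_iff h_nonneg h_one h_mul hs0]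
  have hlim : Tendsto (fun n : ℕ => C * (r / s) ^ n) atTop (𝓝 0) := by
    simpa using (tendsto_pow_atTop_nhds_zero_of_lt_one (div_pos hr hs0).le
      ((div_lt_one hs0).2 hs)).const_mul C
  refine squeeze_zero (fun n => div_nonneg (h_nonneg _) (pow_pos hs0 n).le) (fun n => ?_) hlim
  rw [div_pow, ← mul_div_assoc]
  gcongr
  exact (div_le_iff₀ (pow_pos hr n)).1 (hC n)

theorem spectralSeminorm_pow_le (h_nonneg : ∀ a, 0 ≤ nrm a) (h_one : nrm 1 = 1)
    (h_mul : ∀ a b, nrm (a * b) ≤ nrm a * nrm b) {r : ℝ} (hr : 0 ≤ r) {f : A}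
    (h : spectralSeminorm nrm f ≤ r) (n : ℕ) : spectralSeminorm nrm (f ^ n) ≤ r ^ n := by
  have hlim : Tendsto (fun s : ℝ => s ^ n) (𝓝[>] r) (𝓝 (r ^ n)) :=
    ((continuous_pow n).tendsto r).mono_left nhdsWithin_le_nhds
  refine ge_of_tendsto hlim ?_
  filter_upwards [self_mem_nhdsWithin] with s hs
  have hs0 : 0 ≤ s := hr.trans (le_of_lt hs)
  obtain ⟨N, hN, hlt⟩ := (spectralSeminorm_lt_iff h_nonneg hs0).1 (h.trans_lt hs)
  refine spectralSeminorm_le_of_pow_le h_nonneg (pow_nonneg hs0 n) hN ?_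
  rw [pow_right_comm f, pow_right_comm s]
  exact (nrm_pow_le_pow h_nonneg h_one h_mul _ n).trans (pow_le_pow_left₀ (h_nonneg _) hlt.le n)

end SpectralSeminorm

/-- For a nonarchimedean ring seminorm `nrm` on a commutative ring `A`, a real
`r > 0` and `f ∈ A`:
(1) `‖f^n‖ / r^n → 0` iff `|f|_sp < r`;
(2) if `(‖f^n‖ / r^n)_n` is bounded then `|f|_sp ≤ r`;
(3) if moreover `A` is uniform (`‖g‖ ≤ C·|g|_sp` for some `C > 0` and all `g`), then
`(‖f^n‖ / r^n)_n` is bounded iff `|f|_sp ≤ r`. -/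
theorem stmt_0 {A : Type*} [CommRing A] (nrm : A → ℝ)
    (h_nonneg : ∀ a, 0 ≤ nrm a) (h_zero : nrm 0 = 0) (h_one : nrm 1 = 1)
    (h_add : ∀ a b, nrm (a + b) ≤ max (nrm a) (nrm b))
    (h_mul : ∀ a b, nrm (a * b) ≤ nrm a * nrm b)
    (r : ℝ) (hr : 0 < r) (f : A) :
    (Tendsto (fun n : ℕ => nrm (f ^ n) / r ^ n) atTop (𝓝 0) ↔
        spectralSeminorm nrm f < r) ∧
    ((∃ C : ℝ, ∀ n : ℕ, nrm (f ^ n) / r ^ n ≤ C) → spectralSeminorm nrm f ≤ r) ∧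
    ((∃ C : ℝ, 0 < C ∧ ∀ g : A, nrm g ≤ C * spectralSeminorm nrm g) →
      ((∃ C : ℝ, ∀ n : ℕ, nrm (f ^ n) / r ^ n ≤ C) ↔ spectralSeminorm nrm f ≤ r)) := by
  refine ⟨tendsto_nrm_pow_div_pow_iff h_nonneg h_one h_mul hr f,
    fun ⟨C, hC⟩ => spectralSeminorm_le_of_bounded h_nonneg h_one h_mul hr hC,
    fun ⟨C, hC0, hC⟩ => ⟨fun ⟨D, hD⟩ =>
      spectralSeminorm_le_of_bounded h_nonneg h_one h_mul hr hD, fun h => ⟨C, fun n => ?_⟩⟩⟩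
  rw [div_le_iff₀ (pow_pos hr n)]
  exact (hC _).trans (mul_le_mul_of_nonneg_left
    (spectralSeminorm_pow_le h_nonneg h_one h_mul hr.le h n) hC0.le)
end

section
/- Let A be a commutative ring that is complete with respect to a nonarchimedean ring norm and contains a topologically nilpotent unit (so A is a complete Tate ring), and let f ∈ A be a non-zero-divisor. Then f is not a topological divisor of zero if and only if the principal ideal (f) generated by f is a closed subset of A. -/
open Filter Topology

section NormedRing

variable {A : Type*} [NormedCommRing A]

theorem norm_sub_le_max_norm [IsUltrametricDist A] (a b : A) : ‖a - b‖ ≤ max ‖a‖ ‖b‖ := by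
  simpa [sub_eq_add_neg] using IsUltrametricDist.norm_add_le_max a (-b)

/-- If `g * f → 0` forces `g → 0`, then the principal ideal `(f)` is closed. -/
theorem isClosed_range_mul_right_of_tendsto [CompleteSpace A] {f : A}
    (h : ∀ g : ℕ → A, Tendsto (fun n => g n * f) atTop (𝓝 0) → Tendsto g atTop (𝓝 0)) :
    IsClosed (Set.range (· * f)) := by
  have hcomap : comap (· * f) (𝓝 0) ≤ 𝓝 (0 : A) := by
    have : Tendsto id (comap (· * f) (𝓝 0)) (𝓝 (0 : A)) :=
      tendsto_of_seq_tendsto fun g hg => h g (tendsto_comap_iff.1 hg)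
    exact this
  have hcont : Continuous (AddMonoidHom.mulRight f) := continuous_mul_const f
  have hind : IsInducing (AddMonoidHom.mulRight f) :=
    (IsTopologicalAddGroup.isInducing_iff_nhds_zero).2
      (le_antisymm (by simpa using (hcont.tendsto 0).le_comap) hcomap)
  exact (AddMonoidHom.isUniformInducing_of_isInducing hind).isComplete_range.isClosed

/-- If the principal ideal `(f)` is closed, then by the Baire category theorem the image of some
ball under multiplication by `f` is dense in a neighbourhood of `0` in `(f)`. -/
theorem exists_approx_of_isClosed_range_mul_right [CompleteSpace A] [IsUltrametricDist A] {f : A}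
    (hf : IsClosed (Set.range (· * f))) :
    ∃ (C r : ℝ), 0 ≤ C ∧ 0 < r ∧ ∀ c : A, ‖c * f‖ < r → ∀ δ > 0,
      ∃ a : A, ‖a‖ ≤ C ∧ ‖(c - a) * f‖ < δ := by
  have : CompleteSpace (Set.range (· * f)) := hf.completeSpace_coe
  let φ : A → Set.range (· * f) := Set.rangeFactorization (· * f)
  obtain ⟨n, x, hx⟩ := nonempty_interior_of_iUnion_of_closed
    (f := fun n : ℕ => closure (φ '' Metric.closedBall 0 n)) (fun _ => isClosed_closure) (by
      refine Set.eq_univ_of_forall fun y => ?_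
      obtain ⟨a, rfl⟩ := Set.rangeFactorization_surjective y
      obtain ⟨n, hn⟩ := exists_nat_ge ‖a‖
      exact Set.mem_iUnion.2 ⟨n, subset_closure ⟨a, by simpa using hn, rfl⟩⟩)
  obtain ⟨r, hr, hball⟩ := Metric.isOpen_iff.1 isOpen_interior x hx
  have key : ∀ y : A, dist (φ y) x < r → ∀ δ > 0, ∃ a : A, ‖a‖ ≤ n ∧ ‖(y - a) * f‖ < δ := by
    intro y hy δ hδ
    obtain ⟨-, ⟨a, ha, rfl⟩, hd⟩ := Metric.mem_closure_iff.1 (interior_subset (hball hy)) δ hδ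
    refine ⟨a, by simpa using ha, ?_⟩
    rw [sub_mul, ← dist_eq_norm]
    exact hd
  obtain ⟨b, rfl⟩ := Set.rangeFactorization_surjective x
  refine ⟨n, r, n.cast_nonneg, hr, fun c hc δ hδ => ?_⟩
  obtain ⟨a₁, ha₁, h₁⟩ := key (b + c) (by
    change dist ((b + c) * f) (b * f) < r
    rwa [dist_eq_norm, ← sub_mul, add_sub_cancel_left]) δ hδ
  obtain ⟨a₂, ha₂, h₂⟩ := key b (by simpa [φ] using hr) δ hδ
  refine ⟨a₁ - a₂, (norm_sub_le_max_norm _ _).trans (max_le ha₁ ha₂), ?_⟩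
  have : (c - (a₁ - a₂)) * f = (b + c - a₁) * f - (b - a₂) * f := by ring
  rw [this]
  exact (norm_sub_le_max_norm _ _).trans_lt (max_lt h₁ h₂)

/-- A form of the open mapping theorem over a complete Tate ring: if the principal ideal generated
by a non-zero-divisor `f` is closed, then dividing by `f` is bounded near `0`. -/
theorem exists_norm_le_of_isClosed_range_mul_right [CompleteSpace A] [IsUltrametricDist A]
    {ϖ f : A} (hϖ : IsUnit ϖ) (hϖ0 : Tendsto (fun n : ℕ => ϖ ^ n) atTop (𝓝 0))
    (hf : ∀ a : A, a * f = 0 → a = 0) (hcl : IsClosed (Set.range (· * f))) :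
    ∃ (C r : ℝ), 0 ≤ C ∧ 0 < r ∧ ∀ c : A, ‖c * f‖ < r → ‖c‖ ≤ C := by
  obtain ⟨C, r, hC, hr, happ⟩ := exists_approx_of_isClosed_range_mul_right hcl
  obtain ⟨v, hv⟩ := hϖ.exists_right_inv
  have hvk (k : ℕ) : ϖ ^ k * v ^ k = 1 := by rw [← mul_pow, hv, one_pow]
  have step (k : ℕ) : ∃ ρ > 0, ∀ c : A, ‖c * f‖ < ρ → ∀ δ > 0,
      ∃ c' : A, ‖c' - c‖ ≤ ‖ϖ ^ k‖ * C ∧ ‖c' * f‖ < δ := by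
    refine ⟨r / (‖v ^ k‖ + 1), by positivity, fun c hc δ hδ => ?_⟩
    rw [lt_div_iff₀ (by positivity)] at hc
    obtain ⟨a, ha, h⟩ := happ (v ^ k * c) (by
      rw [mul_assoc]
      refine (norm_mul_le _ _).trans_lt (lt_of_le_of_lt ?_ hc)
      nlinarith [norm_nonneg (c * f)]) (δ / (‖ϖ ^ k‖ + 1)) (by positivity)
    refine ⟨c - ϖ ^ k * a, ?_, ?_⟩
    · rw [sub_sub_cancel_left, norm_neg]
      exact (norm_mul_le _ _).trans (by gcongr)
    · rw [lt_div_iff₀ (by positivity)] at h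
      have heq : (c - ϖ ^ k * a) * f = ϖ ^ k * ((v ^ k * c - a) * f) := by
        linear_combination (-c * f) * hvk k
      rw [heq]
      refine (norm_mul_le _ _).trans_lt (lt_of_le_of_lt ?_ h)
      nlinarith [norm_nonneg ((v ^ k * c - a) * f)]
  choose ρ hρ step using step
  let σ (k : ℕ) : ℝ := min (ρ k) (1 / ((k : ℝ) + 1))
  have hσ (k : ℕ) : 0 < σ k := lt_min (hρ k) (by positivity)
  have hnext (k : ℕ) (c : A) : ∃ c' : A, ‖c * f‖ < σ k →
      ‖c' - c‖ ≤ ‖ϖ ^ k‖ * C ∧ ‖c' * f‖ < σ (k + 1) := by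
    by_cases hc : ‖c * f‖ < σ k
    · obtain ⟨c', h⟩ := step k c (hc.trans_le (min_le_left _ _)) _ (hσ (k + 1))
      exact ⟨c', fun _ => h⟩
    · exact ⟨0, fun h => absurd h hc⟩
  choose next hnext using hnext
  obtain ⟨M, hM⟩ := hϖ0.norm.bddAbove_range
  have hM' (k : ℕ) : ‖ϖ ^ k‖ ≤ M := hM ⟨k, rfl⟩
  have hM0 : 0 ≤ M := (norm_nonneg _).trans (hM' 0)
  refine ⟨M * C, σ 0, by positivity, hσ 0, fun c hc => ?_⟩
  let u (k : ℕ) : A := Nat.rec c next k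
  have hu (k : ℕ) : ‖u k * f‖ < σ k := by
    induction k with
    | zero => exact hc
    | succ k ih => exact (hnext k (u k) ih).2
  have hd (k : ℕ) : ‖u (k + 1) - u k‖ ≤ ‖ϖ ^ k‖ * C := (hnext k (u k) (hu k)).1
  have hcauchy : CauchySeq u := by
    refine NonarchimedeanAddGroup.cauchySeq_of_tendsto_sub_nhds_zero
      (squeeze_zero_norm hd ?_)
    simpa using hϖ0.norm.mul_const C
  obtain ⟨l, hl⟩ := cauchySeq_tendsto_of_complete hcauchy
  have huf : Tendsto (fun k => u k * f) atTop (𝓝 0) :=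
    squeeze_zero_norm (fun k => (hu k).le.trans (min_le_right _ _))
      tendsto_one_div_add_atTop_nhds_zero_nat
  obtain rfl : l = 0 := hf l (tendsto_nhds_unique (hl.mul_const f) huf)
  have hbound (k : ℕ) : ‖c - u k‖ ≤ M * C := by
    induction k with
    | zero => simpa [u] using mul_nonneg hM0 hC
    | succ k ih =>
      rw [← sub_sub_sub_cancel_right c _ (u k)]
      refine (norm_sub_le_max_norm _ _).trans (max_le ih ((hd k).trans ?_))
      gcongr
      exact hM' k
  exact le_of_tendsto' (by simpa using (hl.const_sub c).norm) hbound

/-- In a complete Tate ring, if the principal ideal generated by a non-zero-divisor `f` is closed,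
then `g * f → 0` forces `g → 0`. -/
theorem tendsto_of_isClosed_range_mul_right [CompleteSpace A] [IsUltrametricDist A]
    {ϖ f : A} (hϖ : IsUnit ϖ) (hϖ0 : Tendsto (fun n : ℕ => ϖ ^ n) atTop (𝓝 0))
    (hf : ∀ a : A, a * f = 0 → a = 0) (hcl : IsClosed (Set.range (· * f)))
    {g : ℕ → A} (hg : Tendsto (fun n => g n * f) atTop (𝓝 0)) : Tendsto g atTop (𝓝 0) := by
  obtain ⟨C, r, hC, hr, hbound⟩ := exists_norm_le_of_isClosed_range_mul_right hϖ hϖ0 hf hcl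
  obtain ⟨v, hv⟩ := hϖ.exists_right_inv
  rw [Metric.tendsto_atTop]
  intro ε hε
  have hk : Tendsto (fun k : ℕ => ‖ϖ ^ k‖ * C) atTop (𝓝 0) := by
    simpa using hϖ0.norm.mul_const C
  obtain ⟨k, hk⟩ := (hk.eventually_lt_const hε).exists
  have hvg : Tendsto (fun n => ‖v ^ k * (g n * f)‖) atTop (𝓝 0) := by
    simpa using (hg.const_mul (v ^ k)).norm
  obtain ⟨N, hN⟩ := eventually_atTop.1 (hvg.eventually_lt_const hr)
  refine ⟨N, fun n hn => ?_⟩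
  have hle := hbound (v ^ k * g n) (by rw [mul_assoc]; exact hN n hn)
  have heq : g n = ϖ ^ k * (v ^ k * g n) := by
    rw [← mul_assoc, ← mul_pow, hv, one_pow, one_mul]
  rw [dist_zero_right, heq]
  refine ((norm_mul_le _ _).trans ?_).trans_lt hk
  gcongr

end NormedRing

/-- Let `A` be a commutative ring complete with respect to a nonarchimedean ring
norm `nrm`, containing a topologically nilpotent unit (so `A` is a complete Tate ring), and let
`f ∈ A` be a non-zero-divisor.  Then `f` is not a topological divisor of zero if and only if the
principal ideal generated by `f` is closed in `A` (i.e. contains every element of its metric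
closure). -/
theorem stmt_1 {A : Type*} [CommRing A] (nrm : A → ℝ)
    (h_nonneg : ∀ a, 0 ≤ nrm a) (h_zero : nrm 0 = 0) (h_one : nrm 1 = 1)
    (h_add : ∀ a b, nrm (a + b) ≤ max (nrm a) (nrm b))
    (h_mul : ∀ a b, nrm (a * b) ≤ nrm a * nrm b)
    (h_def : ∀ a, nrm a = 0 → a = 0)
    (h_complete : ∀ u : ℕ → A,
      (∀ ε > (0 : ℝ), ∃ N : ℕ, ∀ m ≥ N, ∀ n ≥ N, nrm (u m - u n) < ε) →
      ∃ x : A, ∀ ε > (0 : ℝ), ∃ N : ℕ, ∀ n ≥ N, nrm (u n - x) < ε)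
    (h_tate : ∃ ϖ : A, IsUnit ϖ ∧ Tendsto (fun n : ℕ => nrm (ϖ ^ n)) atTop (𝓝 0))
    (f : A) (hf : ∀ a : A, f * a = 0 → a = 0) :
    (¬ ∃ (g : ℕ → A) (ε : ℝ), 0 < ε ∧ (∀ n, ε ≤ nrm (g n)) ∧
        Tendsto (fun n : ℕ => nrm (g n * f)) atTop (𝓝 0)) ↔
    (∀ x : A, (∀ ε > (0 : ℝ), ∃ a : A, nrm (x - a * f) < ε) → ∃ a : A, x = a * f) := by
  have hneg (a : A) : nrm (-a) ≤ nrm (-1) * nrm a := by simpa using h_mul (-1) a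
  have hC : 0 ≤ nrm (-1) := h_nonneg _
  have hmax (a b : A) :
      max (nrm (a + b)) (nrm (-(a + b))) ≤ max (max (nrm a) (nrm (-a))) (max (nrm b) (nrm (-b))) := by
    refine max_le ((h_add a b).trans ?_) ?_
    · exact max_le_max (le_max_left _ _) (le_max_left _ _)
    · rw [neg_add]
      exact (h_add _ _).trans (max_le_max (le_max_right _ _) (le_max_right _ _))
  -- The symmetrized norm `max (nrm a) (nrm (-a))` makes `A` a normed ring in the usual sense.
  let N : RingNorm A :=
    { toFun := fun a => max (nrm a) (nrm (-a))
      map_zero' := by simp [h_zero]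
      add_le' := fun a b => (hmax a b).trans <| max_le_add_of_nonneg
        ((h_nonneg a).trans (le_max_left _ _)) ((h_nonneg b).trans (le_max_left _ _))
      neg' := fun a => by simp [max_comm]
      mul_le' := fun a b => by
        refine max_le ((h_mul a b).trans ?_) ?_
        · gcongr
          exacts [h_nonneg b, (h_nonneg a).trans (le_max_left _ _), le_max_left _ _,
            le_max_left _ _]
        · rw [← neg_mul]
          refine (h_mul (-a) b).trans ?_
          gcongr
          exacts [h_nonneg b, (h_nonneg a).trans (le_max_left _ _), le_max_right _ _,
            le_max_left _ _]
      eq_zero_of_map_eq_zero' := fun a ha =>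
        h_def a (le_antisymm ((le_max_left _ _).trans ha.le) (h_nonneg a)) }
  let _ : NormedCommRing A := { N.toNormedRing with mul_comm := mul_comm }
  have hnorm (a : A) : ‖a‖ = max (nrm a) (nrm (-a)) := rfl
  have hle (a : A) : nrm a ≤ ‖a‖ := le_max_left _ _
  have hge (a : A) : ‖a‖ ≤ (nrm (-1) + 1) * nrm a := by
    rw [hnorm]
    exact max_le (by nlinarith [h_nonneg a]) (by nlinarith [h_nonneg a, hneg a])
  have htend (g : ℕ → A) :
      Tendsto g atTop (𝓝 0) ↔ Tendsto (fun n => nrm (g n)) atTop (𝓝 0) := by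
    refine ⟨fun h => squeeze_zero (fun n => h_nonneg _) (fun n => hle _)
      (tendsto_zero_iff_norm_tendsto_zero.1 h), fun h => squeeze_zero_norm (fun n => hge _) ?_⟩
    simpa using h.const_mul (nrm (-1) + 1)
  have : IsUltrametricDist A :=
    IsUltrametricDist.isUltrametricDist_of_forall_norm_add_le_max_norm hmax
  have : CompleteSpace A := by
    refine Metric.complete_of_cauchySeq_tendsto fun u hu => ?_
    obtain ⟨x, hx⟩ := h_complete u fun ε hε => by
      obtain ⟨n, hn⟩ := Metric.cauchySeq_iff.1 hu ε hε
      exact ⟨n, fun m hm k hk => (hle _).trans_lt (by simpa [dist_eq_norm] using hn m hm k hk)⟩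
    refine ⟨x, tendsto_sub_nhds_zero_iff.1 ((htend _).2 (Metric.tendsto_atTop.2 fun ε hε => ?_))⟩
    simpa [abs_of_nonneg (h_nonneg _)] using hx ε hε
  have hclosed : (∀ x : A, (∀ ε > (0 : ℝ), ∃ a : A, nrm (x - a * f) < ε) → ∃ a : A, x = a * f) ↔
      IsClosed (Set.range (· * f)) := by
    have hmem (x : A) : x ∈ closure (Set.range (· * f)) ↔
        ∀ ε > (0 : ℝ), ∃ a : A, nrm (x - a * f) < ε := by
      simp only [Metric.mem_closure_range_iff, dist_eq_norm]
      refine ⟨fun h ε hε => (h ε hε).imp fun a => (hle _).trans_lt, fun h ε hε => ?_⟩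
      obtain ⟨a, ha⟩ := h (ε / (nrm (-1) + 1)) (by positivity)
      rw [lt_div_iff₀' (by positivity)] at ha
      exact ⟨a, (hge _).trans_lt ha⟩
    simp only [← hmem, ← closure_subset_iff_isClosed, Set.subset_def, Set.mem_range, eq_comm]
  have htdz : (¬ ∃ (g : ℕ → A) (ε : ℝ), 0 < ε ∧ (∀ n, ε ≤ nrm (g n)) ∧
        Tendsto (fun n : ℕ => nrm (g n * f)) atTop (𝓝 0)) ↔
      ∀ g : ℕ → A, Tendsto (fun n => g n * f) atTop (𝓝 0) → Tendsto g atTop (𝓝 0) := by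
    constructor
    · intro h g hg
      by_contra hg0
      rw [htend, Metric.tendsto_atTop] at hg0
      push Not at hg0
      obtain ⟨ε, hε, hg0⟩ := hg0
      choose m hm hmε using hg0
      refine h ⟨g ∘ m, ε, hε, fun n => ?_, ?_⟩
      · simpa [abs_of_nonneg (h_nonneg _)] using hmε n
      · exact ((htend _).1 hg).comp (tendsto_atTop_mono hm tendsto_id)
    · rintro h ⟨g, ε, hε, hg, hgf⟩
      exact hε.not_ge (ge_of_tendsto' ((htend g).1 (h g ((htend _).2 hgf))) hg)
  rw [htdz, hclosed]
  obtain ⟨ϖ, hϖ, hϖ0⟩ := h_tate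
  exact ⟨isClosed_range_mul_right_of_tendsto, fun h g =>
    tendsto_of_isClosed_range_mul_right hϖ ((htend _).2 hϖ0)
      (fun a ha => hf a (by rwa [mul_comm])) h⟩
end

section
/- Let A be a commutative ring that is complete with respect to a nonarchimedean ring norm, contains a topologically nilpotent unit (so A is a complete Tate ring), is Noetherian, and is an integral domain. Then A has no nonzero topological divisors of zero: for every f ≠ 0 in A, there is no sequence (g_n) in A with ‖g_n·f‖ → 0 while ‖g_n‖ ≥ ε for all n for some ε > 0. -/
open Filter Topology

/-- An open mapping theorem for Banach modules over a ring with a topologically nilpotent unit: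
small elements of the target lift to small elements of the source. -/
theorem exists_small_preimage {A M N : Type*} [NormedCommRing A]
    [NormedAddCommGroup M] [Module A M] [IsBoundedSMul A M] [IsUltrametricDist M] [CompleteSpace M]
    [NormedAddCommGroup N] [Module A N] [IsBoundedSMul A N] [CompleteSpace N]
    {ϖ : Aˣ} (hϖ : Tendsto (fun n : ℕ => (ϖ : A) ^ n) atTop (𝓝 0))
    (φ : M →ₗ[A] N) (hφ : Continuous φ) (hsurj : Function.Surjective φ) {ε : ℝ} (hε : 0 < ε) :
    ∃ δ > 0, ∀ y : N, ‖y‖ < δ → ∃ x : M, φ x = y ∧ ‖x‖ < ε := by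
  set v : A := ((ϖ⁻¹ : Aˣ) : A)
  have hϖv : (ϖ : A) * v = 1 := ϖ.mul_inv
  have hϖv_pow (k : ℕ) : (ϖ : A) ^ k * v ^ k = 1 := by rw [← mul_pow, hϖv, one_pow]
  have hsmul_tendsto (x : M) : Tendsto (fun k : ℕ => (ϖ : A) ^ k • x) atTop (𝓝 0) := by
    simpa using hϖ.smul_const x
  let T : AddSubgroup N :=
    (IsUltrametricDist.closedBall_openAddSubgroup M one_pos).toAddSubgroup.map φ.toAddMonoidHom
  have hT (y : N) : y ∈ T ↔ ∃ x : M, ‖x‖ ≤ 1 ∧ φ x = y := by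
    refine exists_congr fun x => and_congr_left fun _ => ?_
    exact mem_closedBall_zero_iff
  let S (k : ℕ) : AddSubgroup N :=
    T.topologicalClosure.comap (DistribSMul.toAddMonoidHom N ((ϖ : A) ^ k))
  have hS (k : ℕ) (y : N) : y ∈ S k ↔ (ϖ : A) ^ k • y ∈ T.topologicalClosure := Iff.rfl
  -- By Baire, the closure of the image of the unit ball is a neighbourhood of zero.
  obtain ⟨k, y₀, hy₀⟩ : ∃ k, (interior (S k : Set N)).Nonempty := by
    refine nonempty_interior_of_iUnion_of_closed (fun k => ?_) ?_
    · exact T.isClosed_topologicalClosure.preimage (continuous_const_smul ((ϖ : A) ^ k))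
    · refine Set.eq_univ_of_forall fun y => ?_
      obtain ⟨x, rfl⟩ := hsurj y
      have hx := (hsmul_tendsto x).eventually (Metric.closedBall_mem_nhds 0 one_pos)
      obtain ⟨k, hk⟩ := hx.exists
      refine Set.mem_iUnion.2 ⟨k, T.le_topologicalClosure ?_⟩
      exact (hT _).2 ⟨_, mem_closedBall_zero_iff.1 hk, map_smul φ _ _⟩
  have hSk : (S k : Set N) ∈ 𝓝 0 :=
    ((S k).isOpen_of_mem_nhds (mem_interior_iff_mem_nhds.1 hy₀)).mem_nhds (S k).zero_mem
  have hclosure : (T.topologicalClosure : Set N) ∈ 𝓝 0 := by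
    have hc : Tendsto (fun y : N => v ^ k • y) (𝓝 0) (𝓝 0) := by
      simpa using (continuous_const_smul (v ^ k)).tendsto (0 : N)
    filter_upwards [hc hSk] with y hy
    have hy' := (hS k _).1 hy
    rwa [smul_smul, hϖv_pow, one_smul] at hy'
  obtain ⟨δ, hδ, hball⟩ := Metric.mem_nhds_iff.1 hclosure
  -- One step of the successive approximation.
  have hstep (y : Metric.ball (0 : N) δ) :
      ∃ (x : M) (z : Metric.ball (0 : N) δ), ‖x‖ ≤ 1 ∧ (y : N) = φ x + (ϖ : A) • (z : N) := by
    have hc : Tendsto (fun t : N => v • ((y : N) - t)) (𝓝 (y : N)) (𝓝 0) := by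
      have : Continuous fun t : N => v • ((y : N) - t) := by fun_prop
      simpa using this.tendsto (y : N)
    obtain ⟨t, ht, htT⟩ := mem_closure_iff_nhds.1 (hball y.2) _
      (hc (Metric.ball_mem_nhds 0 hδ))
    obtain ⟨x, hx, rfl⟩ := (hT t).1 htT
    refine ⟨x, ⟨_, ht⟩, hx, ?_⟩
    rw [smul_smul, hϖv, one_smul, add_sub_cancel]
  choose a next ha hnext using hstep
  obtain ⟨C, hC⟩ : ∃ C, ∀ n : ℕ, ‖(ϖ : A) ^ n‖ ≤ C := by
    obtain ⟨C, hC⟩ := hϖ.norm.bddAbove_range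
    exact ⟨C, fun n => hC ⟨n, rfl⟩⟩
  have hC0 : 0 ≤ C := (norm_nonneg _).trans (hC 0)
  have hlift (y : Metric.ball (0 : N) δ) : ∃ x : M, φ x = y ∧ ‖x‖ ≤ C := by
    let b (n : ℕ) : M := (ϖ : A) ^ n • a (next^[n] y)
    have hb (n : ℕ) : ‖b n‖ ≤ ‖(ϖ : A) ^ n‖ :=
      (norm_smul_le _ _).trans (mul_le_of_le_one_right (norm_nonneg _) (ha _))
    have hb_tendsto : Tendsto b atTop (𝓝 0) :=
      squeeze_zero_norm hb (by simpa using hϖ.norm)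
    have hsum : Summable b := by
      apply NonarchimedeanAddGroup.summable_of_tendsto_cofinite_zero
      rwa [Nat.cofinite_eq_atTop]
    have hpartial (n : ℕ) :
        (y : N) = φ (∑ i ∈ Finset.range n, b i) + (ϖ : A) ^ n • (next^[n] y : N) := by
      induction n with
      | zero => simp
      | succ n ih =>
        rw [ih, Finset.sum_range_succ, map_add, map_smul, hnext (next^[n] y),
          Function.iterate_succ_apply', smul_add, smul_smul, pow_succ, add_assoc]
    have hrem : Tendsto (fun n : ℕ => (ϖ : A) ^ n • (next^[n] y : N)) atTop (𝓝 0) := by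
      refine squeeze_zero_norm (a := fun n : ℕ => ‖(ϖ : A) ^ n‖ * δ) (fun n => ?_)
        (by simpa using hϖ.norm.mul_const δ)
      refine (norm_smul_le _ _).trans (mul_le_mul_of_nonneg_left ?_ (norm_nonneg _))
      exact (mem_ball_zero_iff.1 (next^[n] y).2).le
    refine ⟨∑' n, b n, ?_, IsUltrametricDist.norm_tsum_le_of_forall_le fun n => (hb n).trans (hC n)⟩
    have hlim := ((hφ.tendsto _).comp hsum.hasSum.tendsto_sum_nat).add hrem
    rw [add_zero] at hlim
    exact tendsto_nhds_unique hlim (tendsto_const_nhds.congr hpartial)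
  obtain ⟨m, hm⟩ : ∃ m : ℕ, ‖(ϖ : A) ^ m‖ * C < ε := by
    have h : Tendsto (fun m : ℕ => ‖(ϖ : A) ^ m‖ * C) atTop (𝓝 0) := by
      simpa using hϖ.norm.mul_const C
    exact (h.eventually_lt_const hε).exists
  have hc : Tendsto (fun y : N => v ^ m • y) (𝓝 0) (𝓝 0) := by
    simpa using (continuous_const_smul (v ^ m)).tendsto (0 : N)
  obtain ⟨η, hη, hη'⟩ := Metric.mem_nhds_iff.1 (hc (Metric.ball_mem_nhds 0 hδ))
  refine ⟨η, hη, fun y hy => ?_⟩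
  obtain ⟨x, hx, hxC⟩ := hlift ⟨_, hη' (mem_ball_zero_iff.2 hy)⟩
  refine ⟨(ϖ : A) ^ m • x, ?_, ?_⟩
  · rw [map_smul, hx, smul_smul, hϖv_pow, one_smul]
  · exact ((norm_smul_le _ _).trans (mul_le_mul_of_nonneg_left hxC (norm_nonneg _))).trans_lt hm

/-- Ideals of a Noetherian complete Tate ring are closed. -/
theorem isClosed_ideal_of_isNoetherianRing {A : Type*} [NormedCommRing A] [IsUltrametricDist A]
    [CompleteSpace A] [IsNoetherianRing A] {ϖ : Aˣ}
    (hϖ : Tendsto (fun n : ℕ => (ϖ : A) ^ n) atTop (𝓝 0)) (I : Ideal A) :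
    IsClosed (I : Set A) := by
  suffices h : I.closure ≤ I from closure_subset_iff_isClosed.1 h
  have : CompleteSpace I.closure :=
    (isClosed_closure (s := (I : Set A))).completeSpace_coe
  have : IsBoundedSMul A I.closure := .of_norm_smul_le fun a x => norm_mul_le a (x : A)
  obtain ⟨n, x, hx⟩ := Submodule.fg_iff_exists_fin_generating_family.1
    (IsNoetherian.noetherian (⊤ : Submodule A I.closure))
  let φ : (Fin n → A) →ₗ[A] I.closure := Fintype.linearCombination A x
  have hφ_apply (c : Fin n → A) : ((φ c : I.closure) : A) = ∑ i, c i * x i := by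
    simp [φ, Fintype.linearCombination_apply]
  have hφ : Continuous φ := by
    refine Continuous.subtype_mk (f := fun c => ((φ c : I.closure) : A)) ?_ _
    simp only [hφ_apply]
    fun_prop
  have hsurj : Function.Surjective φ := by
    rw [← LinearMap.range_eq_top, Fintype.range_linearCombination, hx]
  -- Matrices close to the identity are invertible.
  have hdet : ∀ᶠ B : Fin n → Fin n → A in 𝓝 0, IsUnit (1 - Matrix.of B).det := by
    have hc : Continuous fun B : Fin n → Fin n → A => (1 - Matrix.of B).det :=
      (continuous_const.sub continuous_id).matrix_det
    refine hc.continuousAt.eventually (Units.isOpen.mem_nhds ?_)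
    simp
  obtain ⟨ε, hε, hball⟩ := Metric.eventually_nhds_iff_ball.1 hdet
  obtain ⟨δ, hδ, hlift⟩ := exists_small_preimage hϖ φ hφ hsurj hε
  have happrox (i : Fin n) : ∃ B : Fin n → A, ‖B‖ < ε ∧ (x i : A) - φ B ∈ I := by
    obtain ⟨y, hyI, hy⟩ := Metric.mem_closure_iff.1 (x i).2 δ hδ
    let z : I.closure := x i - ⟨y, subset_closure hyI⟩
    obtain ⟨B, hB, hBε⟩ := hlift z (by simpa [z, dist_eq_norm] using hy)
    refine ⟨B, hBε, ?_⟩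
    simpa [hB, z] using hyI
  choose B hBε hBI using happrox
  have hu : IsUnit (1 - Matrix.of B).det :=
    hball B (mem_ball_zero_iff.2 ((pi_norm_lt_iff hε).2 hBε))
  have hmul (i : Fin n) : ((1 - Matrix.of B).mulVec fun j => (x j : A)) i ∈ I := by
    rw [Matrix.sub_mulVec, Matrix.one_mulVec]
    simpa [Matrix.mulVec, dotProduct, hφ_apply] using hBI i
  have hxI (i : Fin n) : (x i : A) ∈ I := by
    have h : (x i : A) = ((1 - Matrix.of B)⁻¹.mulVec
        ((1 - Matrix.of B).mulVec fun j => (x j : A))) i := by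
      rw [Matrix.mulVec_mulVec, Matrix.nonsing_inv_mul _ hu, Matrix.one_mulVec]
    rw [h]
    rw [Matrix.mulVec, dotProduct]
    exact I.sum_mem fun j _ => I.mul_mem_left _ (hmul j)
  intro y hy
  obtain ⟨c, hc⟩ := hsurj ⟨y, hy⟩
  have hy' : y = ∑ i, c i * x i := by rw [← hφ_apply, hc]
  rw [hy']
  exact I.sum_mem fun i _ => I.mul_mem_left _ (hxI i)

/-- In a Noetherian complete Tate domain, multiplication by a nonzero element reflects
convergence to zero. -/
theorem exists_norm_lt_of_norm_mul_lt {A : Type*} [NormedCommRing A] [IsUltrametricDist A]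
    [CompleteSpace A] [IsNoetherianRing A] [IsDomain A] {ϖ : Aˣ}
    (hϖ : Tendsto (fun n : ℕ => (ϖ : A) ^ n) atTop (𝓝 0)) {f : A} (hf : f ≠ 0)
    {ε : ℝ} (hε : 0 < ε) :
    ∃ δ > 0, ∀ g : A, ‖g * f‖ < δ → ‖g‖ < ε := by
  let I : Ideal A := Ideal.span {f}
  have : CompleteSpace I := (isClosed_ideal_of_isNoetherianRing hϖ I).completeSpace_coe
  have : IsBoundedSMul A I := .of_norm_smul_le fun a x => norm_mul_le a (x : A)
  let φ : A →ₗ[A] I := LinearMap.toSpanSingleton A I ⟨f, Ideal.mem_span_singleton_self f⟩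
  have hφ : Continuous φ :=
    Continuous.subtype_mk (f := fun g => (φ g : A)) (continuous_id.mul continuous_const) _
  have hsurj : Function.Surjective φ := by
    rintro ⟨y, hy⟩
    obtain ⟨g, hg⟩ := Ideal.mem_span_singleton'.1 hy
    exact ⟨g, Subtype.ext hg⟩
  obtain ⟨δ, hδ, hlift⟩ := exists_small_preimage hϖ φ hφ hsurj hε
  refine ⟨δ, hδ, fun g hg => ?_⟩
  obtain ⟨x, hx, hxε⟩ := hlift (φ g) hg
  have hxg : x * f = g * f := congrArg Subtype.val hx
  rwa [← mul_right_cancel₀ hf hxg]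

open Filter Topology

/-- A Noetherian complete Tate ring (complete with respect to a nonarchimedean ring
norm, with a topologically nilpotent unit) whose underlying ring is an integral domain has no
nonzero topological divisors of zero. -/
theorem stmt_2 {A : Type*} [CommRing A] [IsDomain A] [IsNoetherianRing A] (nrm : A → ℝ)
    (h_nonneg : ∀ a, 0 ≤ nrm a) (h_zero : nrm 0 = 0) (h_one : nrm 1 = 1)
    (h_add : ∀ a b, nrm (a + b) ≤ max (nrm a) (nrm b))
    (h_mul : ∀ a b, nrm (a * b) ≤ nrm a * nrm b)
    (h_def : ∀ a, nrm a = 0 → a = 0)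
    (h_complete : ∀ u : ℕ → A,
      (∀ ε > (0 : ℝ), ∃ N : ℕ, ∀ m ≥ N, ∀ n ≥ N, nrm (u m - u n) < ε) →
      ∃ x : A, ∀ ε > (0 : ℝ), ∃ N : ℕ, ∀ n ≥ N, nrm (u n - x) < ε)
    (h_tate : ∃ ϖ : A, IsUnit ϖ ∧ Tendsto (fun n : ℕ => nrm (ϖ ^ n)) atTop (𝓝 0)) :
    ∀ f : A, f ≠ 0 →
      ¬ ∃ (g : ℕ → A) (ε : ℝ), 0 < ε ∧ (∀ n, ε ≤ nrm (g n)) ∧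
        Tendsto (fun n : ℕ => nrm (g n * f)) atTop (𝓝 0) := by
  intro f hf
  rintro ⟨g, ε, hε, hg, hgf⟩
  obtain ⟨ϖ, ⟨u, rfl⟩, hu⟩ := h_tate
  have hmax (a b : A) : max (nrm (a + b)) (nrm (-(a + b))) ≤
      max (max (nrm a) (nrm (-a))) (max (nrm b) (nrm (-b))) := by
    refine max_le ((h_add a b).trans (max_le_max (le_max_left _ _) (le_max_left _ _))) ?_
    rw [neg_add]
    exact (h_add _ _).trans (max_le_max (le_max_right _ _) (le_max_right _ _))
  let N : RingNorm A :=
    { toFun := fun a => max (nrm a) (nrm (-a))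
      map_zero' := by simp [h_zero]
      add_le' := fun a b => (hmax a b).trans
        (max_le_add_of_nonneg (le_max_of_le_left (h_nonneg a)) (le_max_of_le_left (h_nonneg b)))
      neg' := fun a => by rw [neg_neg, max_comm]
      mul_le' := fun a b => by
        rw [← mul_neg]
        refine max_le ((h_mul a b).trans ?_) ((h_mul a (-b)).trans ?_)
        · exact mul_le_mul (le_max_left _ _) (le_max_left _ _) (h_nonneg _)
            (le_max_of_le_left (h_nonneg _))
        · exact mul_le_mul (le_max_left _ _) (le_max_right _ _) (h_nonneg _)
            (le_max_of_le_left (h_nonneg _))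
      eq_zero_of_map_eq_zero' := fun a ha =>
        h_def a (le_antisymm ((le_max_left _ _).trans ha.le) (h_nonneg a)) }
  let _ : NormedCommRing A := { N.toNormedRing, ‹CommRing A› with }
  have hnorm (a : A) : ‖a‖ = max (nrm a) (nrm (-a)) := rfl
  have hle (a : A) : nrm a ≤ ‖a‖ := le_max_left _ _
  let K : ℝ := max 1 (nrm (-1))
  have hK (a : A) : ‖a‖ ≤ K * nrm a := by
    rw [hnorm, max_mul_of_nonneg _ _ (h_nonneg a), one_mul]
    refine max_le_max le_rfl ?_
    simpa using h_mul (-1) a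
  have hKpos : 0 < K := lt_max_of_lt_left one_pos
  have htendsto {a : ℕ → A} (ha : Tendsto (fun n => nrm (a n)) atTop (𝓝 0)) :
      Tendsto a atTop (𝓝 0) :=
    squeeze_zero_norm (fun n => hK (a n)) (by simpa using ha.const_mul K)
  have : IsUltrametricDist A :=
    IsUltrametricDist.isUltrametricDist_of_forall_norm_add_le_max_norm hmax
  have : CompleteSpace A := by
    refine Metric.complete_of_cauchySeq_tendsto fun a ha => ?_
    obtain ⟨x, hx⟩ := h_complete a fun ε hε => by
      obtain ⟨n₀, hn₀⟩ := Metric.cauchySeq_iff.1 ha ε hε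
      refine ⟨n₀, fun m hm n hn => (hle _).trans_lt ?_⟩
      rw [← dist_eq_norm]
      exact hn₀ m hm n hn
    refine ⟨x, tendsto_sub_nhds_zero_iff.1 (htendsto ?_)⟩
    refine Metric.tendsto_atTop.2 fun ε hε => ?_
    obtain ⟨n₀, hn₀⟩ := hx ε hε
    refine ⟨n₀, fun n hn => ?_⟩
    rw [Real.dist_0_eq_abs, abs_of_nonneg (h_nonneg _)]
    exact hn₀ n hn
  obtain ⟨δ, hδ, hlt⟩ := exists_norm_lt_of_norm_mul_lt (htendsto hu) hf hε
  obtain ⟨n, hn⟩ := ((htendsto hgf).norm.eventually_lt_const (by simpa using hδ)).exists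
  exact absurd ((hle _).trans_lt (hlt (g n) hn)) (hg n).not_gt
end

section
/- Let A be a commutative ring equipped with a nonarchimedean ring seminorm ‖·‖, and let I ⊊ A be a proper ideal that is not dense with respect to ‖·‖. Then there exists a multiplicative nonarchimedean seminorm φ : A → ℝ (φ ≥ 0, φ(0) = 0, φ(1) = 1, φ(a·b) = φ(a)·φ(b), φ(a + b) ≤ max(φ(a), φ(b))) with φ(a) ≤ ‖a‖ for all a ∈ A and I contained in ker φ = {a ∈ A | φ(a) = 0}. In particular, I is contained in the prime ideal ker φ, which is closed for the topology defined by ‖·‖. -/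
/-- A pointwise infimum of a nonempty chain of nonarchimedean ring seminorms, each taking the
value `1` at `1`, is again such a ring seminorm. -/
theorem exists_ringSeminorm_le_of_isChain {A : Type*} [CommRing A] {ι : Type*} [Nonempty ι]
    (p : ι → RingSeminorm A) (hna : ∀ i, IsNonarchimedean (p i)) (hone : ∀ i, p i 1 = 1)
    (hchain : ∀ i j, (∀ x, p i x ≤ p j x) ∨ ∀ x, p j x ≤ p i x) :
    ∃ f : RingSeminorm A, IsNonarchimedean f ∧ f 1 = 1 ∧ ∀ i x, f x ≤ p i x := by
  have hbdd (x : A) : BddBelow (Set.range fun i => p i x) :=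
    ⟨0, by rintro _ ⟨i, rfl⟩; exact apply_nonneg _ _⟩
  have hle (x : A) (i : ι) : ⨅ i, p i x ≤ p i x := ciInf_le (hbdd x) i
  have hnonneg (x : A) : 0 ≤ ⨅ i, p i x := le_ciInf fun i => apply_nonneg _ _
  have hlt (x y : A) (r s : ℝ) (hr : ⨅ i, p i x < r) (hs : ⨅ i, p i y < s) :
      ∃ i, p i x < r ∧ p i y < s := by
    obtain ⟨i, hi⟩ := exists_lt_of_ciInf_lt hr
    obtain ⟨j, hj⟩ := exists_lt_of_ciInf_lt hs
    rcases hchain i j with h | h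
    · exact ⟨i, hi, (h y).trans_lt hj⟩
    · exact ⟨j, (h x).trans_lt hi, hj⟩
  have hmax : IsNonarchimedean fun x => ⨅ i, p i x := by
    intro x y
    refine le_of_forall_gt_imp_ge_of_dense fun r hr => ?_
    obtain ⟨i, hi, hj⟩ := hlt x y r r (max_lt_iff.1 hr).1 (max_lt_iff.1 hr).2
    exact (hle _ i).trans ((hna i x y).trans (max_le hi.le hj.le))
  refine ⟨{ toFun := fun x => ⨅ i, p i x
            map_zero' := by simp
            add_le' := fun x y => (hmax x y).trans
              (max_le_add_of_nonneg (hnonneg x) (hnonneg y))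
            neg' := by simp
            mul_le' := fun x y => ?_ }, hmax, ?_, fun i x => hle x i⟩
  · refine le_mul_of_forall_lt₀ fun r hr s hs => ?_
    obtain ⟨i, hi, hj⟩ := hlt x y r s hr hs
    exact (hle _ i).trans ((map_mul_le_mul (p i) x y).trans
      (mul_le_mul hi.le hj.le (apply_nonneg _ _) ((apply_nonneg _ _).trans hi.le)))
  · change ⨅ i, p i 1 = 1
    simp [hone]

/-- Below every nonarchimedean ring seminorm with value `1` at `1` there is a minimal one. -/
theorem exists_minimal_ringSeminorm {A : Type*} [CommRing A] (P : RingSeminorm A)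
    (hna : IsNonarchimedean P) (hone : P 1 = 1) :
    ∃ f : RingSeminorm A, IsNonarchimedean f ∧ f 1 = 1 ∧ (∀ x, f x ≤ P x) ∧
      ∀ g : RingSeminorm A, IsNonarchimedean g → g 1 = 1 → (∀ x, g x ≤ f x) →
        ∀ x, g x = f x := by
  let S := {p : RingSeminorm A // IsNonarchimedean p ∧ p 1 = 1 ∧ ∀ x, p x ≤ P x}
  let r : S → S → Prop := fun p q => ∀ x, q.1 x ≤ p.1 x
  have : Nonempty S := ⟨⟨P, hna, hone, fun _ => le_rfl⟩⟩
  obtain ⟨m, hm⟩ := exists_maximal_of_nonempty_chains_bounded (r := r)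
    (fun c hc hne => by
      have : Nonempty c := hne.to_subtype
      obtain ⟨f, hf, hf1, hfle⟩ := exists_ringSeminorm_le_of_isChain (fun i : c => i.1.1)
        (fun i => i.1.2.1) (fun i => i.1.2.2.1) (fun i j => by
          rcases eq_or_ne i.1 j.1 with h | h
          · exact Or.inl fun x => by rw [h]
          · exact (hc i.2 j.2 h).symm)
      obtain ⟨a, ha⟩ := hne
      exact ⟨⟨f, hf, hf1, fun x => (hfle ⟨a, ha⟩ x).trans (a.2.2.2 x)⟩,
        fun b hb x => hfle ⟨b, hb⟩ x⟩)
    (fun hab hbc x => (hbc x).trans (hab x))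
  refine ⟨m.1, m.2.1, m.2.2.1, m.2.2.2, fun g hg hg1 hgm x => (hgm x).antisymm ?_⟩
  exact hm ⟨g, hg, hg1, fun x => (hgm x).trans (m.2.2.2 x)⟩ hgm x

/-- A minimal nonarchimedean ring seminorm with value `1` at `1` is multiplicative. -/
theorem map_mul_of_minimal_ringSeminorm {A : Type*} [CommRing A] (f : RingSeminorm A)
    (hna : IsNonarchimedean f) (hone : f 1 = 1)
    (hmin : ∀ g : RingSeminorm A, IsNonarchimedean g → g 1 = 1 → (∀ x, g x ≤ f x) →
      ∀ x, g x = f x) (x y : A) : f (x * y) = f x * f y := by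
  have hsmooth (x : A) : smoothingFun f x = f x :=
    hmin (smoothingSeminorm f hone.le hna) (isNonarchimedean_smoothingFun f hone.le hna)
      ((smoothingFun_of_powMul f hone.le (by simp [hone])).trans hone)
      (smoothingFun_le_self f) x
  have hpm : IsPowMul f := by
    have h := isPowMul_smoothingFun f hone.le
    rwa [funext hsmooth] at h
  by_cases hx : f x = 0
  · have h := map_mul_le_mul f x y
    rw [hx, zero_mul] at h ⊢
    exact h.antisymm (apply_nonneg _ _)
  · have hconst (y : A) : seminormFromConst' x f y = f y :=
      hmin (seminormFromConst hone.le hx hpm) (seminormFromConst_isNonarchimedean hone.le hx hpm hna)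
        (seminormFromConst_one hone.le hx hpm) (seminormFromConst_le_seminorm hone.le hx hpm) y
    simpa only [hconst] using seminormFromConst_const_mul hone.le hx hpm y

/-- A nonarchimedean ring seminorm with value `1` at `1` bounds a multiplicative one. -/
theorem exists_mul_ringSeminorm_le {A : Type*} [CommRing A] (P : RingSeminorm A)
    (hna : IsNonarchimedean P) (hone : P 1 = 1) :
    ∃ f : RingSeminorm A, IsNonarchimedean f ∧ f 1 = 1 ∧ (∀ x y, f (x * y) = f x * f y) ∧
      ∀ x, f x ≤ P x := by
  obtain ⟨f, hf, hf1, hle, hmin⟩ := exists_minimal_ringSeminorm P hna hone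
  exact ⟨f, hf, hf1, map_mul_of_minimal_ringSeminorm f hf hf1 hmin, hle⟩

/-- The quotient of a submultiplicative nonarchimedean function by an ideal, pulled back to the
ring and normalised to take the value `1` at `1`. -/
theorem exists_ringSeminorm_vanishing_on {A : Type*} [CommRing A] (N : A → ℝ)
    (h_nonneg : ∀ a, 0 ≤ N a) (h_zero : N 0 = 0) (h_neg : ∀ a, N (-a) = N a)
    (h_add : IsNonarchimedean N) (h_mul : ∀ a b, N (a * b) ≤ N a * N b) (I : Ideal A)
    {δ : ℝ} (hδ : 0 < δ) (hI : ∀ h ∈ I, δ ≤ N (1 + h)) :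
    ∃ P : RingSeminorm A, IsNonarchimedean P ∧ P 1 = 1 ∧ (∀ a, P a ≤ N a) ∧
      ∀ a ∈ I, P a = 0 := by
  let q : A → ℝ := fun x => ⨅ h : I, N (x + h)
  have hbdd (x : A) : BddBelow (Set.range fun h : I => N (x + h)) :=
    ⟨0, by rintro _ ⟨i, rfl⟩; exact h_nonneg _⟩
  have hle (x : A) {h : A} (hh : h ∈ I) : q x ≤ N (x + h) := ciInf_le (hbdd x) ⟨h, hh⟩
  have q_nonneg : 0 ≤ q := fun x => le_ciInf fun i => h_nonneg _
  have q_le (x : A) : q x ≤ N x := by simpa using hle x I.zero_mem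
  have q_vanish (x : A) (hx : x ∈ I) : q x = 0 := by
    refine le_antisymm ?_ (q_nonneg x)
    simpa [h_zero] using hle x (I.neg_mem hx)
  have q_neg_le (x : A) : q (-x) ≤ q x := le_ciInf fun h => by
    have := hle (-x) (I.neg_mem h.2)
    rwa [← neg_add, h_neg] at this
  have q_neg (x : A) : q (-x) = q x :=
    (q_neg_le x).antisymm (by simpa using q_neg_le (-x))
  have q_na : IsNonarchimedean q := by
    intro x y
    refine le_of_forall_gt_imp_ge_of_dense fun r hr => ?_
    obtain ⟨h, hh⟩ := exists_lt_of_ciInf_lt (max_lt_iff.1 hr).1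
    obtain ⟨k, hk⟩ := exists_lt_of_ciInf_lt (max_lt_iff.1 hr).2
    refine (hle (x + y) (I.add_mem h.2 k.2)).trans ?_
    rw [add_add_add_comm]
    exact (h_add _ _).trans (max_le hh.le hk.le)
  have q_mul (x y : A) : q (x * y) ≤ q x * q y := by
    refine le_mul_of_forall_lt₀ fun r hr s hs => ?_
    obtain ⟨h, hh⟩ := exists_lt_of_ciInf_lt hr
    obtain ⟨k, hk⟩ := exists_lt_of_ciInf_lt hs
    refine (hle (x * y) (h := x * k + h * (y + k))
      (I.add_mem (I.mul_mem_left _ k.2) (I.mul_mem_right _ h.2))).trans ?_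
    rw [show x * y + (x * k + h * (y + k)) = (x + h) * (y + k) by ring]
    exact (h_mul _ _).trans (mul_le_mul hh.le hk.le (h_nonneg _) ((h_nonneg _).trans hh.le))
  have q_mul' (x y : A) : q (x * y) ≤ 1 * q x * q y := by simpa using q_mul x y
  have q_ne : q ≠ 0 := fun h =>
    (hδ.trans_le (le_ciInf fun k : I => hI k k.2)).ne' (congrFun h 1)
  have P_le (x : A) : seminormFromBounded' q x ≤ q x := by
    simpa using seminormFromBounded_le q_nonneg q_mul' x
  refine ⟨seminormFromBounded (q_vanish 0 I.zero_mem) q_nonneg q_mul'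
    (fun a b => (q_na a b).trans (max_le_add_of_nonneg (q_nonneg a) (q_nonneg b))) q_neg,
    seminormFromBounded_isNonarchimedean q_nonneg q_mul' q_na,
    seminormFromBounded_one q_ne q_nonneg q_mul', fun a => (P_le a).trans (q_le a),
    fun a ha => le_antisymm ((P_le a).trans (q_vanish a ha).le) (apply_nonneg _ _)⟩

/-- A multiplicative function bounded by a constant multiple of a submultiplicative one is bounded
by the latter. -/
theorem le_of_map_mul_of_le_const_mul {A : Type*} [CommRing A] {φ ν : A → ℝ} {C : ℝ}
    (hφ1 : φ 1 = 1) (hφ_mul : ∀ a b, φ (a * b) = φ a * φ b)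
    (hν : ∀ a, 0 ≤ ν a) (hν1 : ν 1 = 1) (hν_mul : ∀ a b, ν (a * b) ≤ ν a * ν b)
    (hle : ∀ a, φ a ≤ C * ν a) (a : A) : φ a ≤ ν a := by
  have hφn (n : ℕ) : φ (a ^ n) = φ a ^ n := by
    induction n with
    | zero => simp [hφ1]
    | succ n ih => rw [pow_succ, hφ_mul, ih, pow_succ]
  have hνn (n : ℕ) : ν (a ^ n) ≤ ν a ^ n := by
    induction n with
    | zero => simp [hν1]
    | succ n ih =>
      rw [pow_succ, pow_succ]
      exact (hν_mul _ _).trans (mul_le_mul_of_nonneg_right ih (hν a))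
  have hpow (n : ℕ) : φ a ^ n ≤ C * ν a ^ n := by
    have hC : 0 ≤ C := by
      have := hle 1
      rw [hφ1, hν1] at this
      linarith
    exact hφn n ▸ (hle _).trans (mul_le_mul_of_nonneg_left (hνn n) hC)
  by_contra! hlt
  rcases (hν a).eq_or_lt with h0 | h0
  · have := hpow 1
    simp only [pow_one, ← h0, mul_zero] at this
    linarith
  · obtain ⟨n, hn⟩ := pow_unbounded_of_one_lt C ((one_lt_div h0).2 hlt)
    rw [div_pow, lt_div_iff₀ (by positivity)] at hn
    exact (hpow n).not_gt hn

/-- Every proper, non-dense ideal of a seminormed commutative ring is contained in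
the kernel of a bounded multiplicative nonarchimedean seminorm (an element of the Gelfand
spectrum). -/
theorem stmt_3 {A : Type*} [CommRing A] (nrm : A → ℝ)
    (h_nonneg : ∀ a, 0 ≤ nrm a) (h_zero : nrm 0 = 0) (h_one : nrm 1 = 1)
    (h_add : ∀ a b, nrm (a + b) ≤ max (nrm a) (nrm b))
    (h_mul : ∀ a b, nrm (a * b) ≤ nrm a * nrm b)
    (I : Ideal A) (hI : I ≠ ⊤)
    (h_not_dense : ¬ ∀ g : A, ∀ ε > (0 : ℝ), ∃ h ∈ I, nrm (g - h) < ε) :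
    ∃ φ : A → ℝ, (∀ a, 0 ≤ φ a) ∧ φ 0 = 0 ∧ φ 1 = 1 ∧
      (∀ a b, φ (a * b) = φ a * φ b) ∧
      (∀ a b, φ (a + b) ≤ max (φ a) (φ b)) ∧
      (∀ a, φ a ≤ nrm a) ∧
      (∀ a ∈ I, φ a = 0) := by
  let N : A → ℝ := fun a => max (nrm a) (nrm (-a))
  have N_nonneg (a : A) : 0 ≤ N a := (h_nonneg a).trans (le_max_left _ _)
  have N_neg (a : A) : N (-a) = N a := by simp [N, max_comm]
  have N_add : IsNonarchimedean N := fun a b => by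
    refine max_le ((h_add a b).trans (max_le_max (le_max_left _ _) (le_max_left _ _))) ?_
    rw [neg_add]
    exact (h_add _ _).trans (max_le_max (le_max_right _ _) (le_max_right _ _))
  have N_mul (a b : A) : N (a * b) ≤ N a * N b := by
    refine max_le ((h_mul a b).trans ?_) ?_
    · exact mul_le_mul (le_max_left _ _) (le_max_left _ _) (h_nonneg _) (N_nonneg _)
    · rw [← neg_mul]
      exact (h_mul _ _).trans
        (mul_le_mul (le_max_right _ _) (le_max_left _ _) (h_nonneg _) (N_nonneg _))
  have N_le (a : A) : N a ≤ max 1 (nrm (-1)) * nrm a := by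
    refine max_le (le_mul_of_one_le_left (h_nonneg a) (le_max_left _ _)) ?_
    rw [← neg_one_mul a]
    exact (h_mul _ _).trans (mul_le_mul_of_nonneg_right (le_max_right _ _) (h_nonneg a))
  push Not at h_not_dense
  obtain ⟨g, ε, hε, hg⟩ := h_not_dense
  have hfar (h : A) (hh : h ∈ I) : ε / (N g + 1) ≤ N (1 + h) := by
    rw [div_le_iff₀ (by linarith [N_nonneg g])]
    have h1 := hg (-(g * h)) (I.neg_mem (I.mul_mem_left g hh))
    rw [show g - -(g * h) = g * (1 + h) by ring] at h1
    have h2 := h1.trans ((le_max_left _ _).trans (N_mul g (1 + h)))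
    nlinarith [N_nonneg (1 + h)]
  obtain ⟨P, hP, hP1, hPN, hPI⟩ := exists_ringSeminorm_vanishing_on N N_nonneg
    (by simp [N, h_zero]) N_neg N_add N_mul I (div_pos hε (by linarith [N_nonneg g])) hfar
  obtain ⟨φ, hφ, hφ1, hφ_mul, hφP⟩ := exists_mul_ringSeminorm_le P hP hP1
  exact ⟨φ, apply_nonneg φ, map_zero φ, hφ1, hφ_mul, hφ,
    le_of_map_mul_of_le_const_mul hφ1 hφ_mul h_nonneg h_one h_mul
      fun a => ((hφP a).trans (hPN a)).trans (N_le a),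
    fun a ha => le_antisymm ((hφP a).trans (hPI a ha).le) (apply_nonneg φ a)⟩
end

section
/- Let A be a nontrivial commutative ring equipped with a multiplicative nonarchimedean ring norm ‖·‖ (in particular A is an integral domain). Then every nonzero ideal of A is dense with respect to ‖·‖ (i.e. ‖·‖ is topologically simple) if and only if the completion of A with respect to ‖·‖ is a field. -/
universe u

/-- A multiplicative nonarchimedean ring norm. -/
def IsMulNonarchNorm {A : Type*} [CommRing A] (v : A → ℝ) : Prop :=
  (∀ a, 0 ≤ v a) ∧ v 0 = 0 ∧ v 1 = 1 ∧
  (∀ a b, v (a + b) ≤ max (v a) (v b)) ∧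
  (∀ a b, v (a * b) = v a * v b) ∧
  (∀ a, v a = 0 → a = 0)

/-- `(B, w, i)` is a completion of the normed ring `(A, v)`: `i` is an isometric ring homomorphism
with dense image and `B` is (sequentially) complete with respect to `w`. -/
def IsNormCompletion {A B : Type*} [CommRing A] [CommRing B]
    (v : A → ℝ) (w : B → ℝ) (i : A →+* B) : Prop :=
  (∀ a, w (i a) = v a) ∧
  (∀ b : B, ∀ ε > (0 : ℝ), ∃ a : A, w (b - i a) < ε) ∧
  (∀ u : ℕ → B,
    (∀ ε > (0 : ℝ), ∃ N : ℕ, ∀ m ≥ N, ∀ n ≥ N, w (u m - u n) < ε) →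
    ∃ x : B, ∀ ε > (0 : ℝ), ∃ N : ℕ, ∀ n ≥ N, w (u n - x) < ε)

/-- The norm attached to `IsMulNonarchNorm v` turns `A` into a normed commutative ring. -/
@[reducible]
def IsMulNonarchNorm.toNormedCommRing {A : Type*} [CommRing A] {v : A → ℝ}
    (hv : IsMulNonarchNorm v) : NormedCommRing A :=
  letI f : RingNorm A :=
    { toFun := v
      map_zero' := hv.2.1
      add_le' := fun a b => (hv.2.2.2.1 a b).trans (max_le_add_of_nonneg (hv.1 a) (hv.1 b))
      neg' := fun a => by
        obtain ⟨h0, -, h1, -, hm, -⟩ := hv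
        have h : v (-1) * v (-1) = 1 := by rw [← hm, neg_mul_neg, one_mul, h1]
        have h' : v (-1) = 1 := by nlinarith [h0 (-1)]
        rw [neg_eq_neg_one_mul, hm, h', one_mul]
      mul_le' := fun a b => (hv.2.2.2.2.1 a b).le
      eq_zero_of_map_eq_zero' := hv.2.2.2.2.2 }
  { f.toNormedRing with mul_comm := mul_comm }

/-- Every ring with a multiplicative nonarchimedean norm has a completion. -/
theorem IsMulNonarchNorm.exists_completion {A : Type u} [CommRing A] {v : A → ℝ}
    (hv : IsMulNonarchNorm v) :
    ∃ (B : Type u) (_ : CommRing B) (w : B → ℝ) (i : A →+* B),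
      IsMulNonarchNorm w ∧ IsNormCompletion v w i := by
  let _ : NormedCommRing A := hv.toNormedCommRing
  obtain ⟨-, -, h1, hadd, hmul, -⟩ := id hv
  refine ⟨UniformSpace.Completion A, inferInstance, fun b => ‖b‖,
    UniformSpace.Completion.coeRingHom,
    ⟨norm_nonneg, norm_zero, ?_, fun a b => ?_, fun a b => ?_, fun a => norm_eq_zero.1⟩,
    fun a => UniformSpace.Completion.norm_coe a, fun b ε hε => ?_, fun u hu => ?_⟩
  · rw [← UniformSpace.Completion.coe_one]
    simp only [UniformSpace.Completion.norm_coe]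
    exact h1
  · induction a, b using UniformSpace.Completion.induction_on₂ with
    | hp => exact isClosed_le (by fun_prop) (by fun_prop)
    | ih a b =>
      rw [← UniformSpace.Completion.coe_add]
      simp only [UniformSpace.Completion.norm_coe]
      exact hadd a b
  · induction a, b using UniformSpace.Completion.induction_on₂ with
    | hp => exact isClosed_eq (by fun_prop) (by fun_prop)
    | ih a b =>
      rw [← UniformSpace.Completion.coe_mul]
      simp only [UniformSpace.Completion.norm_coe]
      exact hmul a b
  · obtain ⟨a, ha⟩ := UniformSpace.Completion.denseRange_coe.exists_dist_lt b hε
    exact ⟨a, by rwa [dist_eq_norm] at ha⟩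
  · have hc : CauchySeq u := Metric.cauchySeq_iff.2 fun ε hε => by
      simpa only [dist_eq_norm] using hu ε hε
    obtain ⟨x, hx⟩ := cauchySeq_tendsto_of_complete hc
    exact ⟨x, fun ε hε => by simpa only [dist_eq_norm] using Metric.tendsto_atTop.1 hx ε hε⟩

/-- In a complete ring, an element at distance less than `1` from `1` is a unit. -/
theorem IsMulNonarchNorm.exists_mul_eq_one {B : Type*} [CommRing B] {w : B → ℝ}
    (hw : IsMulNonarchNorm w)
    (hB : ∀ u : ℕ → B,
      (∀ ε > (0 : ℝ), ∃ N : ℕ, ∀ m ≥ N, ∀ n ≥ N, w (u m - u n) < ε) →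
      ∃ x : B, ∀ ε > (0 : ℝ), ∃ N : ℕ, ∀ n ≥ N, w (u n - x) < ε)
    {b : B} (hb : w (1 - b) < 1) : ∃ c, b * c = 1 := by
  let _ : NormedCommRing B := hw.toNormedCommRing
  have hb' : ‖1 - b‖ < 1 := hb
  have : CompleteSpace B := Metric.complete_of_cauchySeq_tendsto fun u hu => by
    obtain ⟨x, hx⟩ := hB u fun ε hε => by
      obtain ⟨N, hN⟩ := Metric.cauchySeq_iff.1 hu ε hε
      exact ⟨N, fun m hm n hn => by
        have := hN m hm n hn
        rwa [dist_eq_norm] at this⟩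
    refine ⟨x, Metric.tendsto_atTop.2 fun ε hε => ?_⟩
    simp only [dist_eq_norm]
    exact hx ε hε
  simpa using (isUnit_one_sub_of_norm_lt_one hb').exists_right_inv

/-- Let `A` be a nontrivial commutative ring with a multiplicative nonarchimedean
norm `v` (so `A` is an integral domain).  Then every nonzero ideal of `A` is dense with respect to
`v` (i.e. `v` is topologically simple) if and only if the completion of `A` with respect to `v`
is a field. -/
theorem stmt_7 {A : Type u} [CommRing A] [Nontrivial A] (v : A → ℝ)
    (hv : IsMulNonarchNorm v) :
    (∀ I : Ideal A, I ≠ ⊥ → ∀ g : A, ∀ ε > (0 : ℝ), ∃ h ∈ I, v (g - h) < ε) ↔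
    (∀ (B : Type u) [CommRing B], ∀ (w : B → ℝ) (i : A →+* B),
      IsMulNonarchNorm w → IsNormCompletion v w i → IsField B) := by
  constructor
  · intro hI B _ w i hw hc
    obtain ⟨hiso, hdense, hcomp⟩ := hc
    obtain ⟨hw0, hwz, hw1, hwadd, hwmul, hwd⟩ := id hw
    refine ⟨⟨0, 1, fun h => by rw [← h, hwz] at hw1; exact zero_ne_one hw1⟩, mul_comm, ?_⟩
    intro b hb
    have hbpos : 0 < w b := (hw0 b).lt_of_ne fun h => hb (hwd b h.symm)
    obtain ⟨a, ha⟩ := hdense b (w b) hbpos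
    have hba : w b ≤ v a := by
      have h := hwadd (b - i a) (i a)
      rw [sub_add_cancel, hiso] at h
      exact (le_max_iff.1 h).resolve_left ha.not_ge
    have ha0 : a ≠ 0 := by
      rintro rfl
      rw [hv.2.1] at hba
      exact hba.not_gt hbpos
    obtain ⟨h, hh, hlt⟩ := hI (Ideal.span {a}) (by simpa using ha0) 1 1 one_pos
    obtain ⟨c, rfl⟩ := Ideal.mem_span_singleton'.1 hh
    have hac : v c * v a ≤ 1 := by
      have hneg : v (-(1 - c * a)) = v (1 - c * a) :=
        letI := hv.toNormedCommRing
        norm_neg (1 - c * a)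
      have h := hv.2.2.2.1 1 (-(1 - c * a))
      rw [hneg, hv.2.2.1, max_eq_left hlt.le] at h
      rw [← hv.2.2.2.2.1]
      convert h using 2
      ring
    have hcpos : 0 < v c := (hv.1 c).lt_of_ne fun h => by
      have hc0 := hv.2.2.2.2.2 c h.symm
      rw [hc0, zero_mul, sub_zero, hv.2.2.1] at hlt
      exact lt_irrefl _ hlt
    have hunit : w (1 - b * i c) < 1 := by
      have hneg : w (-((b - i a) * i c)) = w ((b - i a) * i c) :=
        letI := hw.toNormedCommRing
        norm_neg ((b - i a) * i c)
      have hsplit : 1 - b * i c = i (1 - c * a) + -((b - i a) * i c) := by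
        simp only [map_sub, map_one, map_mul]
        ring
      rw [hsplit]
      refine (hwadd _ _).trans_lt (max_lt (by rwa [hiso]) ?_)
      rw [hneg, hwmul, hiso]
      nlinarith
    obtain ⟨d, hd⟩ := hw.exists_mul_eq_one hcomp hunit
    exact ⟨i c * d, by rw [← mul_assoc, hd]⟩
  · intro hfield I hI g ε hε
    obtain ⟨B, _, w, i, hw, hc⟩ := hv.exists_completion
    have hB := hfield B w i hw hc
    obtain ⟨a, haI, ha⟩ := Submodule.exists_mem_ne_zero_of_ne_bot hI
    have hva : 0 < v a := (hv.1 a).lt_of_ne fun h => ha (hv.2.2.2.2.2 a h.symm)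
    obtain ⟨c, hac⟩ := hB.mul_inv_cancel (a := i a) fun h => by
      rw [← hc.1, h, hw.2.1] at hva
      exact lt_irrefl _ hva
    obtain ⟨h, hh⟩ := hc.2.1 (i g * c) (ε / v a) (div_pos hε hva)
    refine ⟨a * h, I.mul_mem_right h haI, ?_⟩
    have hsplit : i (g - a * h) = i a * (i g * c - i h) := by
      simp only [map_sub, map_mul]
      linear_combination (-i g) * hac
    rw [← hc.1, hsplit, hw.2.2.2.2.1, hc.1, mul_comm]
    exact (lt_div_iff₀ hva).1 hh
end

section
/- Let K be a complete nonarchimedean normed field and let C be a complete, algebraically closed nonarchimedean normed field together with an isometric embedding of K into C such that the set of elements of C algebraic over K is dense in C (so C is a completed algebraic closure of K). Assume C is spherically complete. Then there exists no topologically simple nonarchimedean ring norm on K[T] restricting to the norm of K on constants: for every nonarchimedean ring norm v on K[T] with v(c) = ‖c‖ for all constants c ∈ K, there exist a nonzero ideal I of K[T], an element g ∈ K[T], and ε > 0 such that v(g − h) ≥ ε for all h ∈ I. -/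
/-- The pointwise infimum of a nonempty chain of power-multiplicative nonarchimedean ring seminorms
normalised at `1` is again such a seminorm. -/
theorem exists_powMul_lowerBound_of_isChain {R : Type*} [CommRing R] (c : Set (R → ℝ))
    (hc : ∀ p ∈ c, ∃ q : RingSeminorm R, ⇑q = p ∧ IsPowMul q ∧ IsNonarchimedean q ∧ q 1 = 1)
    (hchain : IsChain (· ≤ ·) c) (hne : c.Nonempty) :
    ∃ q : RingSeminorm R, (IsPowMul q ∧ IsNonarchimedean q ∧ q 1 = 1) ∧ ∀ p ∈ c, ⇑q ≤ p := by
  have : Nonempty c := hne.to_subtype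
  have hnn : ∀ p ∈ c, ∀ x, 0 ≤ p x := by
    intro p hp x
    obtain ⟨q, rfl, -⟩ := hc p hp
    exact apply_nonneg q x
  have hbdd : ∀ x, BddBelow (Set.range fun p : c ↦ p.1 x) := fun x ↦
    ⟨0, by rintro _ ⟨p, rfl⟩; exact hnn p.1 p.2 x⟩
  set m : R → ℝ := fun x ↦ ⨅ p : c, p.1 x with hm
  have hle : ∀ p ∈ c, ∀ x, m x ≤ p x := fun p hp x ↦ ciInf_le (hbdd x) ⟨p, hp⟩
  have hnonneg : ∀ x, 0 ≤ m x := fun x ↦ le_ciInf fun p ↦ hnn p.1 p.2 x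
  have hcommon : ∀ p ∈ c, ∀ q ∈ c, ∃ s ∈ c, s ≤ p ∧ s ≤ q := by
    intro p hp q hq
    rcases hchain.total hp hq with h | h
    · exact ⟨p, hp, le_rfl, h⟩
    · exact ⟨q, hq, h, le_rfl⟩
  have hna : IsNonarchimedean m := by
    intro x y
    by_contra! hlt
    obtain ⟨hx, hy⟩ := max_lt_iff.mp hlt
    obtain ⟨p, hp⟩ := exists_lt_of_ciInf_lt hx
    obtain ⟨q, hq⟩ := exists_lt_of_ciInf_lt hy
    obtain ⟨s, hs, hsp, hsq⟩ := hcommon p.1 p.2 q.1 q.2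
    obtain ⟨t, rfl, -, htna, -⟩ := hc s hs
    exact absurd ((hle _ hs (x + y)).trans (htna x y))
      (not_le.mpr (max_lt ((hsp x).trans_lt hp) ((hsq y).trans_lt hq)))
  have hmul : ∀ x y, m (x * y) ≤ m x * m y := by
    intro x y
    have h1 : ∀ p q : c, m (x * y) ≤ p.1 x * q.1 y := by
      intro p q
      obtain ⟨s, hs, hsp, hsq⟩ := hcommon p.1 p.2 q.1 q.2
      obtain ⟨t, rfl, -⟩ := hc s hs
      exact ((hle _ hs (x * y)).trans (map_mul_le_mul t x y)).trans
        (mul_le_mul (hsp x) (hsq y) (apply_nonneg _ _) (hnn p.1 p.2 x))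
    rw [hm]
    simp only
    rw [Real.iInf_mul_of_nonneg (hnonneg y)]
    refine le_ciInf fun p ↦ ?_
    rw [Real.mul_iInf_of_nonneg (hnn p.1 p.2 x)]
    exact le_ciInf fun q ↦ h1 p q
  have hzero : m 0 = 0 := by
    obtain ⟨p, hp⟩ := hne
    refine le_antisymm ?_ (hnonneg 0)
    have h0 := hle p hp 0
    obtain ⟨q, rfl, -⟩ := hc p hp
    simpa using h0
  have hneg : ∀ x, m (-x) = m x := by
    intro x
    refine iInf_congr fun p ↦ ?_
    obtain ⟨q, hq, -⟩ := hc p.1 p.2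
    rw [← hq, map_neg_eq_map]
  have hone : m 1 = 1 := by
    have : ∀ p : c, p.1 1 = 1 := by
      intro p
      obtain ⟨q, hq, -, -, h⟩ := hc p.1 p.2
      rw [← hq, h]
    simp [hm, this]
  refine ⟨{ toFun := m, map_zero' := hzero, add_le' := fun x y ↦ hna.add_le hnonneg,
            neg' := hneg, mul_le' := hmul }, ⟨?_, hna, hone⟩, hle⟩
  intro x n hn
  refine le_antisymm ?_ (le_ciInf fun p ↦ ?_)
  · change m (x ^ n) ≤ m x ^ n
    induction n, hn using Nat.le_induction with
    | base => simp
    | succ k _ ih =>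
      rw [pow_succ, pow_succ]
      exact (hmul _ _).trans (mul_le_mul_of_nonneg_right ih (hnonneg x))
  · change m x ^ n ≤ p.1 (x ^ n)
    have hpx := hle p.1 p.2 x
    obtain ⟨q, hq, hpow, -⟩ := hc p.1 p.2
    rw [← hq] at hpx ⊢
    rw [hpow x hn]
    exact pow_le_pow_left₀ (hnonneg x) hpx n

/-- Every nonarchimedean ring seminorm normalised at `1` dominates a multiplicative one. -/
theorem exists_multiplicative_seminorm_le {R : Type*} [CommRing R] (μ : RingSeminorm R)
    (hμ1 : μ 1 = 1) (hna : IsNonarchimedean μ) :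
    ∃ w : RingSeminorm R, IsNonarchimedean w ∧ w 1 = 1 ∧ (∀ x y, w (x * y) = w x * w y) ∧
      ∀ x, w x ≤ μ x := by
  let S : Set (R → ℝ)ᵒᵈ := {p | ∃ q : RingSeminorm R, ⇑q = OrderDual.ofDual p ∧
    IsPowMul q ∧ IsNonarchimedean q ∧ q 1 = 1}
  let p₀ := smoothingSeminorm μ hμ1.le hna
  have hp₀ : OrderDual.toDual (⇑p₀) ∈ S :=
    ⟨p₀, rfl, isPowMul_smoothingFun μ hμ1.le, isNonarchimedean_smoothingFun μ hμ1.le hna,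
      (smoothingFun_of_powMul μ hμ1.le (by simp [hμ1])).trans hμ1⟩
  obtain ⟨p, hpp₀, hp⟩ := zorn_le_nonempty₀ S (fun c hcS hc y hy ↦ by
    obtain ⟨q, hq, hle⟩ := exists_powMul_lowerBound_of_isChain (OrderDual.toDual ⁻¹' c)
      (fun p hp ↦ hcS hp) hc.symm ⟨y, hy⟩
    exact ⟨OrderDual.toDual ⇑q, ⟨q, rfl, hq⟩, fun z hz ↦ hle z hz⟩) _ hp₀
  obtain ⟨w, hw, hpow, hwna, hw1⟩ := hp.prop
  refine ⟨w, hwna, hw1, fun x y ↦ ?_, fun x ↦ ?_⟩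
  · by_cases hx : w x = 0
    · refine le_antisymm (map_mul_le_mul w x y) ?_
      simp [hx]
    · have hmem : OrderDual.toDual (⇑(seminormFromConst hw1.le hx hpow)) ∈ S :=
        ⟨_, rfl, seminormFromConst_isPowMul hw1.le hx hpow,
          seminormFromConst_isNonarchimedean hw1.le hx hpow hwna,
          seminormFromConst_one hw1.le hx hpow⟩
      have hle : p ≤ OrderDual.toDual (⇑(seminormFromConst hw1.le hx hpow)) := by
        intro z
        change seminormFromConst' x w z ≤ (OrderDual.ofDual p) z
        rw [← hw]
        exact seminormFromConst_le_seminorm hw1.le hx hpow z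
      have heq : ∀ z, seminormFromConst' x w z = w z := fun z ↦
        le_antisymm (seminormFromConst_le_seminorm hw1.le hx hpow z)
          (by rw [hw]; exact hp.le_of_ge hmem hle z)
      have := seminormFromConst_const_mul hw1.le hx hpow y
      rwa [heq, heq, heq] at this
  · rw [hw]
    exact (hpp₀ x).trans (smoothingFun_le_self μ x)

/-- A nonarchimedean ring seminorm on `K[X]` with value `1` at `1` extends to `L[X]` when `L` is a
normed extension of `K` admitting a bounded `K`-linear functional with value `1` at `1`. -/
theorem exists_ringSeminorm_extension {K L : Type*} [NormedField K] [NormedField L] [Algebra K L]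
    (lam : L →ₗ[K] K) (hlam1 : lam 1 = 1) (M : ℝ) (hM : 0 < M) (hlam : ∀ c, ‖lam c‖ ≤ M * ‖c‖)
    (v : RingSeminorm (Polynomial K)) (hv1 : v 1 = 1) (hvna : IsNonarchimedean v)
    (hvC : ∀ c, v (Polynomial.C c) = ‖c‖) :
    ∃ μ : RingSeminorm (Polynomial L), μ 1 = 1 ∧ IsNonarchimedean μ ∧
      (∀ c, μ (Polynomial.C c) ≤ ‖c‖) ∧ ∀ f, μ (f.map (algebraMap K L)) ≤ v f := by
  let S : ℝ → AddSubgroup (Polynomial L) := fun s ↦ AddSubgroup.closure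
    {F | ∃ c f, F = Polynomial.C c * Polynomial.map (algebraMap K L) f ∧ ‖c‖ * v f ≤ s}
  have hgen : ∀ c f, Polynomial.C c * Polynomial.map (algebraMap K L) f ∈ S (‖c‖ * v f) :=
    fun c f ↦ AddSubgroup.subset_closure ⟨c, f, rfl, le_rfl⟩
  have hmono : ∀ s t, s ≤ t → S s ≤ S t := by
    intro s t hst
    refine AddSubgroup.closure_mono ?_
    rintro F ⟨c, f, rfl, h⟩
    exact ⟨c, f, rfl, h.trans hst⟩
  have hmulmem : ∀ s t, 0 ≤ s → ∀ F ∈ S s, ∀ G ∈ S t, F * G ∈ S (s * t) := by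
    intro s t hs F hF G hG
    induction hF using AddSubgroup.closure_induction with
    | mem F hF =>
      obtain ⟨c, f, rfl, hcf⟩ := hF
      induction hG using AddSubgroup.closure_induction with
      | mem G hG =>
        obtain ⟨d, g, rfl, hdg⟩ := hG
        refine AddSubgroup.subset_closure ⟨c * d, f * g, ?_, ?_⟩
        · rw [Polynomial.map_mul, Polynomial.C_mul]; ring
        · calc ‖c * d‖ * v (f * g) ≤ ‖c * d‖ * (v f * v g) :=
                mul_le_mul_of_nonneg_left (map_mul_le_mul v f g) (norm_nonneg _)
            _ = (‖c‖ * v f) * (‖d‖ * v g) := by rw [norm_mul]; ring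
            _ ≤ s * t := mul_le_mul hcf hdg
                (mul_nonneg (norm_nonneg _) (apply_nonneg _ _)) hs
      | zero => simp
      | add G H _ _ ihG ihH => rw [mul_add]; exact add_mem ihG ihH
      | neg G _ ih => rw [mul_neg]; exact neg_mem ih
    | zero => simp
    | add F H _ _ ihF ihH => rw [add_mul]; exact add_mem ihF ihH
    | neg F _ ih => rw [neg_mul]; exact neg_mem ih
  have hcoeff : ∀ s, 0 ≤ s → ∀ F ∈ S s, ∃ g : Polynomial K, v g ≤ M * s ∧
      ∀ n, g.coeff n = lam (F.coeff n) := by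
    intro s hs F hF
    induction hF using AddSubgroup.closure_induction with
    | mem F hF =>
      obtain ⟨c, f, rfl, hcf⟩ := hF
      refine ⟨Polynomial.C (lam c) * f, ?_, fun n ↦ ?_⟩
      · calc v (Polynomial.C (lam c) * f) ≤ ‖lam c‖ * v f := by
              rw [← hvC]; exact map_mul_le_mul v _ _
          _ ≤ M * ‖c‖ * v f := mul_le_mul_of_nonneg_right (hlam c) (apply_nonneg _ _)
          _ = M * (‖c‖ * v f) := by ring
          _ ≤ M * s := mul_le_mul_of_nonneg_left hcf hM.le
      · rw [Polynomial.coeff_C_mul, Polynomial.coeff_C_mul, Polynomial.coeff_map, mul_comm c,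
          ← Algebra.smul_def, map_smul, smul_eq_mul, mul_comm]
    | zero => exact ⟨0, by simpa using mul_nonneg hM.le hs, by simp⟩
    | add F H _ _ ihF ihH =>
      obtain ⟨g, hg, hg'⟩ := ihF
      obtain ⟨h, hh, hh'⟩ := ihH
      exact ⟨g + h, (hvna g h).trans (max_le hg hh), by simp [hg', hh']⟩
    | neg F _ ih =>
      obtain ⟨g, hg, hg'⟩ := ih
      exact ⟨-g, by rwa [map_neg_eq_map], by simp [hg']⟩
  have hmax : ∀ s t, ∀ F ∈ S s, ∀ G ∈ S t, F + G ∈ S (max s t) := fun s t F hF G hG ↦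
    add_mem (hmono _ _ (le_max_left s t) hF) (hmono _ _ (le_max_right s t) hG)
  have hne : ∀ F, {s | 0 ≤ s ∧ F ∈ S s}.Nonempty := by
    intro F
    induction F using Polynomial.induction_on' with
    | add F G hF hG =>
      obtain ⟨s, hs, hF⟩ := hF
      obtain ⟨t, ht, hG⟩ := hG
      exact ⟨max s t, le_max_of_le_left hs, hmax s t F hF G hG⟩
    | monomial n a =>
      refine ⟨‖a‖ * v (Polynomial.X ^ n), mul_nonneg (norm_nonneg _) (apply_nonneg _ _), ?_⟩
      have := hgen a (Polynomial.X ^ n)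
      rwa [Polynomial.map_pow, Polynomial.map_X, Polynomial.C_mul_X_pow_eq_monomial] at this
  let μ : Polynomial L → ℝ := fun F ↦ sInf {s | 0 ≤ s ∧ F ∈ S s}
  have hle : ∀ F s, 0 ≤ s → F ∈ S s → μ F ≤ s := fun F s hs hF ↦
    csInf_le ⟨0, fun _ h ↦ h.1⟩ ⟨hs, hF⟩
  have hnonneg : ∀ F, 0 ≤ μ F := fun F ↦ le_csInf (hne F) fun _ h ↦ h.1
  have hlt : ∀ F r, μ F < r → ∃ s, (0 ≤ s ∧ F ∈ S s) ∧ s < r := fun F r h ↦ by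
    obtain ⟨s, hs, hsr⟩ := exists_lt_of_csInf_lt (hne F) h
    exact ⟨s, hs, hsr⟩
  have hna : IsNonarchimedean μ := by
    intro F G
    by_contra! h
    obtain ⟨hF, hG⟩ := max_lt_iff.mp h
    obtain ⟨s, ⟨hs, hFs⟩, hs'⟩ := hlt F _ hF
    obtain ⟨t, ⟨ht, hGt⟩, ht'⟩ := hlt G _ hG
    exact absurd (hle _ _ (le_max_of_le_left hs) (hmax s t F hFs G hGt))
      (not_le.mpr (max_lt hs' ht'))
  have hmul : ∀ F G, μ (F * G) ≤ μ F * μ G := by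
    intro F G
    refine le_mul_of_forall_lt₀ fun a ha b hb ↦ ?_
    obtain ⟨s, ⟨hs, hFs⟩, hs'⟩ := hlt F _ ha
    obtain ⟨t, ⟨ht, hGt⟩, ht'⟩ := hlt G _ hb
    exact (hle _ _ (mul_nonneg hs ht) (hmulmem s t hs F hFs G hGt)).trans
      (mul_le_mul hs'.le ht'.le ht (hs.trans hs'.le))
  have hgenle : ∀ c f, μ (Polynomial.C c * Polynomial.map (algebraMap K L) f) ≤ ‖c‖ * v f :=
    fun c f ↦ hle _ _ (mul_nonneg (norm_nonneg _) (apply_nonneg _ _)) (hgen c f)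
  have hone_le : μ 1 ≤ 1 := by simpa [hv1] using hgenle 1 1
  have hone_pos : 0 < μ 1 := by
    refine lt_of_lt_of_le (inv_pos.mpr hM) (le_csInf (hne 1) ?_)
    rintro s ⟨hs, h1⟩
    obtain ⟨g, hg, hg'⟩ := hcoeff s hs 1 h1
    have : g = 1 := by
      ext n
      rw [hg', Polynomial.coeff_one, Polynomial.coeff_one]
      split_ifs <;> simp [hlam1]
    rw [this, hv1] at hg
    rwa [inv_le_iff_one_le_mul₀' hM]
  have hone : μ 1 = 1 := by
    refine le_antisymm hone_le ?_
    have := hmul 1 1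
    rw [mul_one] at this
    exact (le_mul_iff_one_le_right hone_pos).mp this
  refine ⟨{ toFun := μ, map_zero' := le_antisymm (hle 0 0 le_rfl (zero_mem _)) (hnonneg 0),
            add_le' := fun x y ↦ hna.add_le hnonneg,
            neg' := fun F ↦ by simp [μ], mul_le' := hmul }, hone, hna, fun c ↦ ?_, fun f ↦ ?_⟩
  · change μ (Polynomial.C c) ≤ _
    simpa [hv1] using hgenle c 1
  · change μ (f.map (algebraMap K L)) ≤ _
    simpa using hgenle 1 f

/-- Over a spherically complete algebraically closed field, every multiplicative nonarchimedean
seminorm on the polynomial ring dominates the evaluation at some point. -/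
theorem exists_norm_eval_le {L : Type*} [NormedField L] [IsAlgClosed L]
    (h_sph : ∀ (a : ℕ → L) (r : ℕ → ℝ), (∀ n, 0 < r n) →
      (∀ n, Metric.closedBall (a (n + 1)) (r (n + 1)) ⊆ Metric.closedBall (a n) (r n)) →
      (⋂ n, Metric.closedBall (a n) (r n)).Nonempty)
    (hL : ∀ x y : L, ‖x + y‖ ≤ max ‖x‖ ‖y‖)
    (w : RingSeminorm (Polynomial L)) (hwna : IsNonarchimedean w) (hw1 : w 1 = 1)
    (hwmul : ∀ f g, w (f * g) = w f * w g) (hwC : ∀ c, w (Polynomial.C c) ≤ ‖c‖) :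
    ∃ a : L, ∀ f : Polynomial L, ‖f.eval a‖ ≤ w f := by
  have hwC' : ∀ c, w (Polynomial.C c) = ‖c‖ := by
    intro c
    refine le_antisymm (hwC c) ?_
    by_cases hc : c = 0
    · simp [hc]
    have h1 : w (Polynomial.C c) * w (Polynomial.C c⁻¹) = 1 := by
      rw [← hwmul, ← Polynomial.C_mul, mul_inv_cancel₀ hc, Polynomial.C_1, hw1]
    have h2 := hwC c⁻¹
    rw [norm_inv] at h2
    have hc' : 0 < ‖c‖ := norm_pos_iff.mpr hc
    have h3 : 1 ≤ w (Polynomial.C c) * ‖c‖⁻¹ := by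
      rw [← h1]; exact mul_le_mul_of_nonneg_left h2 (apply_nonneg _ _)
    rwa [← div_eq_mul_inv, one_le_div hc'] at h3
  let ρ : L → ℝ := fun a ↦ w (Polynomial.X - Polynomial.C a)
  have hρ : ∀ a b, ‖a - b‖ ≤ max (ρ a) (ρ b) := by
    intro a b
    have h := hwna (-(Polynomial.X - Polynomial.C a)) (Polynomial.X - Polynomial.C b)
    rw [map_neg_eq_map] at h
    have h2 : -(Polynomial.X - Polynomial.C a) + (Polynomial.X - Polynomial.C b)
        = Polynomial.C (a - b) := by rw [Polynomial.C_sub]; ring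
    rwa [h2, hwC'] at h
  have hρ' : ∀ a b, ρ a ≤ max (ρ b) ‖b - a‖ := by
    intro a b
    have h := hwna (Polynomial.X - Polynomial.C b) (Polynomial.C (b - a))
    have h2 : (Polynomial.X - Polynomial.C b) + Polynomial.C (b - a)
        = Polynomial.X - Polynomial.C a := by rw [Polynomial.C_sub]; ring
    rwa [h2, hwC'] at h
  have hbdd : BddBelow (Set.range ρ) := ⟨0, by rintro _ ⟨a, rfl⟩; exact apply_nonneg _ _⟩
  obtain ⟨a, ha⟩ : ∃ a, ∀ b, ρ a ≤ ρ b := by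
    set d := ⨅ a, ρ a with hd
    have hd0 : 0 ≤ d := le_ciInf fun a ↦ apply_nonneg _ _
    have hr : ∀ n : ℕ, (0 : ℝ) < 1 / (n + 1) := fun n ↦ Nat.one_div_pos_of_nat
    choose s hs using fun n : ℕ ↦
      exists_lt_of_ciInf_lt (show ⨅ a, ρ a < d + 1 / ((n : ℝ) + 1) from
        lt_add_of_pos_right _ (hr n))
    have hanti : ∀ n : ℕ, d + 1 / (((n + 1 : ℕ) : ℝ) + 1) ≤ d + 1 / ((n : ℝ) + 1) := fun n ↦
      add_le_add_right (Nat.one_div_le_one_div n.le_succ) d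
    obtain ⟨c, hc⟩ := h_sph s (fun n ↦ d + 1 / ((n : ℝ) + 1))
      (fun n ↦ add_pos_of_nonneg_of_pos hd0 (hr n)) (fun n x hx ↦ by
        rw [mem_closedBall_iff_norm] at hx ⊢
        have : x - s n = (x - s (n + 1)) + (s (n + 1) - s n) := by ring
        rw [this]
        refine (hL _ _).trans (max_le (hx.trans (hanti n)) ((hρ _ _).trans (max_le ?_ ?_)))
        · exact (hs (n + 1)).le.trans (hanti n)
        · exact (hs n).le)
    refine ⟨c, fun b ↦ le_trans ?_ (ciInf_le hbdd b)⟩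
    have hlim : Filter.Tendsto (fun n : ℕ ↦ d + 1 / ((n : ℝ) + 1)) Filter.atTop (nhds (d + 0)) :=
      tendsto_const_nhds.add tendsto_one_div_add_atTop_nhds_zero_nat
    rw [add_zero] at hlim
    refine ge_of_tendsto' hlim fun n ↦ (hρ' c (s n)).trans (max_le (hs n).le ?_)
    have := Set.mem_iInter.mp hc n
    rwa [mem_closedBall_iff_norm, norm_sub_rev] at this
  refine ⟨a, fun f ↦ ?_⟩
  rw [(IsAlgClosed.splits f).eq_prod_roots]
  rw [Polynomial.eval_mul, Polynomial.eval_C, norm_mul, hwmul, hwC']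
  refine mul_le_mul_of_nonneg_left ?_ (norm_nonneg _)
  induction f.roots using Multiset.induction_on with
  | empty => simp [hw1]
  | cons b t ih =>
    rw [Multiset.map_cons, Multiset.prod_cons, Polynomial.eval_mul, norm_mul, hwmul]
    refine mul_le_mul ?_ ih (norm_nonneg _) (apply_nonneg _ _)
    simpa using (hρ a b).trans (max_le (ha b) le_rfl)

theorem norm_pow_sub_one_le_norm_sub_one {A : Type*} [NormedField A] [IsUltrametricDist A]
    {y : A} (hy : ‖y - 1‖ ≤ 1) (n : ℕ) : ‖y ^ n - 1‖ ≤ ‖y - 1‖ := by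
  have hy1 : ‖y‖ ≤ 1 := by
    have := IsUltrametricDist.norm_add_le_max (y - 1) 1
    rw [sub_add_cancel, norm_one] at this
    exact this.trans (max_le hy le_rfl)
  rw [← mul_geom_sum, norm_mul]
  refine mul_le_of_le_one_right (norm_nonneg _) ?_
  refine IsUltrametricDist.norm_sum_le_of_forall_le_of_nonneg zero_le_one fun i _ ↦ ?_
  rw [norm_pow]
  exact pow_le_one₀ (norm_nonneg _) hy1

theorem norm_pow_sub_one_le_mul {A : Type*} [NormedField A] [IsUltrametricDist A]
    {y : A} {κ : ℝ} {n : ℕ} (hκ : κ ≤ 1) (hy : ‖y - 1‖ ≤ κ) (hn : ‖(n : A)‖ ≤ κ) :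
    ‖y ^ n - 1‖ ≤ κ * ‖y - 1‖ := by
  rw [← mul_geom_sum, norm_mul, mul_comm]
  refine mul_le_mul_of_nonneg_right ?_ (norm_nonneg _)
  have h : ∑ i ∈ Finset.range n, y ^ i = (∑ i ∈ Finset.range n, (y ^ i - 1)) + n := by
    simp [Finset.sum_sub_distrib]
  rw [h]
  refine (IsUltrametricDist.norm_add_le_max _ _).trans (max_le ?_ hn)
  exact IsUltrametricDist.norm_sum_le_of_forall_le_of_nonneg ((norm_nonneg _).trans hy)
    fun i _ ↦ (norm_pow_sub_one_le_norm_sub_one (hy.trans hκ) i).trans hy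

theorem norm_pow_pow_sub_one_le {A : Type*} [NormedField A] [IsUltrametricDist A]
    {y : A} {κ : ℝ} {n : ℕ} (hκ : κ ≤ 1) (hy : ‖y - 1‖ ≤ κ) (hn : ‖(n : A)‖ ≤ κ) (m : ℕ) :
    ‖y ^ n ^ m - 1‖ ≤ κ ^ m * ‖y - 1‖ := by
  induction m with
  | zero => simp
  | succ m ih =>
    have h := (norm_pow_sub_one_le_norm_sub_one (hy.trans hκ) (n ^ m)).trans hy
    rw [pow_succ, pow_mul, pow_succ' κ, mul_assoc]
    exact (norm_pow_sub_one_le_mul hκ h hn).trans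
      (mul_le_mul_of_nonneg_left ih ((norm_nonneg _).trans hy))

section Automorphisms

variable {K A : Type*} [NontriviallyNormedField K] [NormedField A] [NormedAlgebra K A]

/-- If an automorphism moves elements of the ball of radius `r` by at most `r' < r`, then its
multiplicative cocycle consists of high powers of elements uniformly close to `1`. -/
theorem exists_pow_mul_eq_of_norm_sub_le [IsAlgClosed A] (σ : A ≃ₐ[K] A) {r r' ρ : ℝ}
    (hr' : 0 < r') (hρ0 : 0 < ρ) (hρ : r' < ρ * r) (h : ∀ u, ‖u‖ ≤ r → ‖σ u - u‖ ≤ r') :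
    ∃ N₀ : ℕ, 0 < N₀ ∧ ∀ N ≥ N₀, ∀ u ≠ 0, ∃ y, ‖y - 1‖ ≤ ρ ∧ σ u = y ^ N * u := by
  obtain ⟨π, hπ⟩ := NormedField.exists_one_lt_norm K
  have hr : 0 < r := pos_of_mul_pos_right (hr'.trans hρ) hρ0.le
  have hq : 1 < ρ * r / r' := (one_lt_div hr').mpr hρ
  obtain ⟨n, hn⟩ := pow_unbounded_of_one_lt ‖π‖ hq
  refine ⟨n + 1, n.succ_pos, fun N hN u hu ↦ ?_⟩
  have hN0 : 0 < N := lt_of_lt_of_le n.succ_pos hN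
  obtain ⟨w, hw⟩ := IsAlgClosed.exists_pow_nat_eq (algebraMap K A π) hN0
  obtain ⟨z, hz⟩ := IsAlgClosed.exists_pow_nat_eq u hN0
  have hwN : ‖w‖ ^ N = ‖π‖ := by rw [← norm_pow, hw, norm_algebraMap']
  have hw1 : 1 < ‖w‖ := by
    by_contra! hle
    exact absurd (pow_le_one₀ (n := N) (norm_nonneg w) hle) (by rw [hwN]; exact not_le.mpr hπ)
  have hwq : ‖w‖ ≤ ρ * r / r' := by
    refine le_of_pow_le_pow_left₀ hN0.ne' (zero_le_one.trans hq.le) ?_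
    rw [hwN]
    exact hn.le.trans (pow_le_pow_right₀ hq.le (by lia))
  have hw0 : w ≠ 0 := norm_pos_iff.mp (zero_lt_one.trans hw1)
  have hz0 : z ≠ 0 := by
    rintro rfl
    exact hu (by rw [← hz, zero_pow hN0.ne'])
  have hz0' : 0 < ‖z‖ := norm_pos_iff.mpr hz0
  obtain ⟨k, hk1, hk2⟩ := exists_mem_Ico_zpow (div_pos hr hz0') hw1
  set t := z * w ^ k with ht
  have ht0 : t ≠ 0 := mul_ne_zero hz0 (zpow_ne_zero _ hw0)
  have ht0' : 0 < ‖t‖ := norm_pos_iff.mpr ht0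
  have htr : ‖t‖ ≤ r := by
    rw [ht, norm_mul, norm_zpow, mul_comm]
    exact (le_div_iff₀ hz0').mp hk1
  have htr' : r < ‖t‖ * ‖w‖ := by
    rw [div_lt_iff₀ hz0', zpow_add_one₀ (zero_lt_one.trans hw1).ne'] at hk2
    rw [ht, norm_mul, norm_zpow]
    linarith
  have htN : t ^ N = u * algebraMap K A (π ^ k) := by
    rw [ht, mul_pow, hz, ← zpow_natCast, zpow_comm, zpow_natCast, hw, map_zpow₀]
  refine ⟨σ t / t, ?_, ?_⟩
  · rw [div_sub_one ht0, norm_div, div_le_iff₀ ht0']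
    refine (h t htr).trans ?_
    have h1 : r < ‖t‖ * (ρ * r / r') :=
      htr'.trans_le (mul_le_mul_of_nonneg_left hwq (norm_nonneg _))
    rw [mul_div_assoc', lt_div_iff₀ hr'] at h1
    have h2 : r * r' < r * (ρ * ‖t‖) := by linarith
    exact (lt_of_mul_lt_mul_left h2 hr.le).le
  · have hπk : algebraMap K A (π ^ k) ≠ 0 := by
      rw [← norm_pos_iff, norm_algebraMap', norm_zpow]
      exact zpow_pos (zero_lt_one.trans hπ) k
    rw [div_pow, ← map_pow, htN, map_mul, AlgEquiv.commutes]
    field_simp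

theorem exists_pow_algEquiv_apply_eq [Algebra.IsAlgebraic K A] (σ : A ≃ₐ[K] A) (u : A) :
    ∃ n : ℕ, 0 < n ∧ (σ ^ n) u = u := by
  have hroot : ∀ k : ℕ, (σ ^ k) u ∈ (minpoly K u).rootSet A := by
    intro k
    rw [Polynomial.mem_rootSet]
    refine ⟨minpoly.ne_zero (Algebra.IsIntegral.isIntegral u), ?_⟩
    rw [Polynomial.aeval_algHom_apply, minpoly.aeval, map_zero]
  obtain ⟨a, b, hab, heq⟩ := Finite.exists_ne_map_eq_of_infinite
    (fun k ↦ (⟨(σ ^ k) u, hroot k⟩ : (minpoly K u).rootSet A))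
  have heq' : (σ ^ a) u = (σ ^ b) u := congrArg Subtype.val heq
  wlog hlt : a < b generalizing a b
  · exact this b a hab.symm heq.symm heq'.symm (by lia)
  refine ⟨b - a, by lia, ?_⟩
  have : σ ^ b = σ ^ a * σ ^ (b - a) := by rw [← pow_add]; congr 1; lia
  rw [this, AlgEquiv.mul_apply] at heq'
  exact ((σ ^ a).injective heq').symm

variable [IsUltrametricDist K] [CompleteSpace K] [Algebra.IsAlgebraic K A]

theorem norm_algEquiv_apply (σ : A ≃ₐ[K] A) (x : A) : ‖σ x‖ = ‖x‖ := by
  rw [NormedAlgebra.norm_eq_spectralNorm K, NormedAlgebra.norm_eq_spectralNorm K x,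
    ← spectralNorm_eq_of_equiv]

/-- An automorphism of an algebraically closed algebraic extension which moves every element of
some ball around `0` by at most a fixed distance smaller than the radius is trivial. -/
theorem algEquiv_eq_one_of_norm_sub_le [IsUltrametricDist A] [IsAlgClosed A] (σ : A ≃ₐ[K] A)
    {r r' : ℝ} (hr' : 0 < r') (hrr : r' < r) (h : ∀ u, ‖u‖ ≤ r → ‖σ u - u‖ ≤ r') : σ = 1 := by
  have hr : 0 < r := hr'.trans hrr
  obtain ⟨ρ, hρ1, hρ2⟩ := exists_between ((div_lt_one hr).mpr hrr)
  have hρ0 : 0 < ρ := (div_pos hr' hr).trans hρ1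
  obtain ⟨N₀, hN₀, hN⟩ :=
    exists_pow_mul_eq_of_norm_sub_le σ hr' hρ0 ((div_lt_iff₀ hr).mp hρ1) h
  by_cases hn : ∃ n : ℕ, 0 < n ∧ ‖(n : A)‖ < 1
  · obtain ⟨n, hn0, hn1⟩ := hn
    have hn2 : 1 < n := by
      rcases Nat.lt_or_ge 1 n with h | h
      · exact h
      · obtain rfl : n = 1 := by lia
        simp at hn1
    ext u
    by_cases hu : u = 0
    · simp [hu]
    set κ := max ρ ‖(n : A)‖
    have hκ : κ < 1 := max_lt hρ2 hn1
    have hκ0 : 0 ≤ κ := hρ0.le.trans (le_max_left _ _)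
    have hbound : ∀ m ≥ N₀, ‖σ u - u‖ ≤ κ ^ m * ‖u‖ := by
      intro m hm
      obtain ⟨y, hy, hyu⟩ := hN (n ^ m) (hm.trans (Nat.lt_pow_self hn2).le) u hu
      rw [hyu, ← sub_one_mul, norm_mul]
      refine mul_le_mul_of_nonneg_right ?_ (norm_nonneg _)
      refine (norm_pow_pow_sub_one_le hκ.le (hy.trans (le_max_left _ _)) (le_max_right _ _)
        m).trans (mul_le_of_le_one_right (pow_nonneg hκ0 m) (hy.trans hρ2.le))
    have hlim : Filter.Tendsto (fun m : ℕ ↦ κ ^ m * ‖u‖) Filter.atTop (nhds (0 * ‖u‖)) :=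
      (tendsto_pow_atTop_nhds_zero_of_lt_one hκ0 hκ).mul_const _
    rw [zero_mul] at hlim
    have := ge_of_tendsto hlim (Filter.eventually_atTop.mpr ⟨N₀, hbound⟩)
    simpa [sub_eq_zero] using this
  · push Not at hn
    have hσ : ∀ u, ‖σ u - u‖ ≤ ρ * ‖u‖ := by
      intro u
      by_cases hu : u = 0
      · simp [hu]
      obtain ⟨y, hy, hyu⟩ := hN N₀ le_rfl u hu
      rw [hyu, ← sub_one_mul, norm_mul]
      exact mul_le_mul_of_nonneg_right
        ((norm_pow_sub_one_le_norm_sub_one (hy.trans hρ2.le) _).trans hy) (norm_nonneg _)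
    ext u
    obtain ⟨n, hn0, hnu⟩ := exists_pow_algEquiv_apply_eq σ u
    set y := σ u - u with hy
    have hyk : ∀ k : ℕ, ‖(σ ^ k) y - y‖ ≤ ρ * ‖y‖ := by
      intro k
      induction k with
      | zero => simpa using mul_nonneg hρ0.le (norm_nonneg y)
      | succ k ih =>
        have : (σ ^ (k + 1)) y - y = σ ((σ ^ k) y - y) + (σ y - y) := by
          rw [pow_succ', AlgEquiv.mul_apply, map_sub σ ((σ ^ k) y) y]; ring
        rw [this]
        refine (IsUltrametricDist.norm_add_le_max _ _).trans (max_le ?_ (hσ y))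
        rwa [norm_algEquiv_apply]
    have hsum : ∑ k ∈ Finset.range n, (σ ^ k) y = 0 := by
      have : ∀ k, (σ ^ k) y = (σ ^ (k + 1)) u - (σ ^ k) u := by
        intro k
        rw [hy, map_sub, pow_succ, AlgEquiv.mul_apply]
      simp_rw [this]
      rw [Finset.sum_range_sub (fun k ↦ (σ ^ k) u), hnu]
      simp
    have hny : ‖(n : A) * y‖ ≤ ρ * ‖y‖ := by
      have : (n : A) * y = -∑ k ∈ Finset.range n, ((σ ^ k) y - y) := by
        rw [Finset.sum_sub_distrib, hsum]
        simp
      rw [this, norm_neg]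
      exact IsUltrametricDist.norm_sum_le_of_forall_le_of_nonneg
        (mul_nonneg hρ0.le (norm_nonneg _)) fun k _ ↦ hyk k
    rw [norm_mul] at hny
    have h1 := hn n hn0
    have hy0 : ‖y‖ = 0 := by nlinarith [norm_nonneg y]
    simpa [hy, sub_eq_zero] using hy0

end Automorphisms

open IntermediateField in
/-- If only the identity automorphism fixes `x`, then every separable element lies in `K⟮x⟯`. -/
theorem mem_adjoin_of_forall_algEquiv_eq_one {K A : Type*} [Field K] [Field A] [Algebra K A]
    [Algebra.IsAlgebraic K A] [IsAlgClosed A] {x : A}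
    (hx : ∀ σ : A ≃ₐ[K] A, σ x = x → σ = 1) {s : A} (hs : IsSeparable K s) : s ∈ K⟮x⟯ := by
  have : IsAlgClosure K⟮x⟯ A := ⟨inferInstance, inferInstance⟩
  have : Normal K⟮x⟯ A := inferInstance
  have hs' : IsSeparable K⟮x⟯ s := hs.tower_top K⟮x⟯
  have hint : IsIntegral K⟮x⟯ s := Algebra.IsIntegral.isIntegral s
  have huniq : ∀ t ∈ (minpoly K⟮x⟯ s).rootSet A, t = s := by
    intro t ht
    obtain ⟨σ, hσ⟩ := minpoly.exists_algEquiv_of_root' (K := K⟮x⟯)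
      (Algebra.IsAlgebraic.isAlgebraic s) (Polynomial.mem_rootSet.mp ht).2
    have h1 := hx (σ.restrictScalars K) (σ.commutes (AdjoinSimple.gen K x))
    rw [← hσ]
    exact DFunLike.congr_fun h1 s
  have hcard : Fintype.card ((minpoly K⟮x⟯ s).rootSet A) ≤ 1 :=
    Fintype.card_le_one_iff.mpr fun a b ↦
      Subtype.ext ((huniq a a.2).trans (huniq b b.2).symm)
  rw [Polynomial.card_rootSet_eq_natDegree hs' (IsAlgClosed.splits _)] at hcard
  have hdeg : (minpoly K⟮x⟯ s).natDegree = 1 := le_antisymm hcard (minpoly.natDegree_pos hint)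
  obtain ⟨y, hy⟩ := minpoly.natDegree_eq_one_iff.mp hdeg
  rw [← hy]
  exact y.2

/-- Separable elements are dense among the algebraic elements of an algebraically closed normed
extension. -/
theorem exists_isSeparable_norm_sub_lt {K L : Type*} [NontriviallyNormedField K] [NormedField L]
    [NormedAlgebra K L] [IsAlgClosed L] {z : L} (hz : IsIntegral K z) {ε : ℝ} (hε : 0 < ε) :
    ∃ s : L, IsSeparable K s ∧ ‖z - s‖ < ε := by
  by_cases hsep : IsSeparable K z
  · exact ⟨z, hsep, by simpa using hε⟩
  set f := minpoly K z with hf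
  have hmonic : f.Monic := minpoly.monic hz
  have hder : f.derivative = 0 := by
    by_contra h
    exact hsep ((Polynomial.separable_iff_derivative_ne_zero (minpoly.irreducible hz)).mpr h)
  have hdeg : 1 < f.natDegree := by
    by_contra! hle
    have h1 : f.natDegree = 1 := le_antisymm hle (minpoly.natDegree_pos hz)
    have h2 : f.derivative.coeff 0 = 1 := by
      rw [Polynomial.coeff_derivative, zero_add, ← h1, hmonic.coeff_natDegree]
      simp
    rw [hder] at h2
    simp at h2
  obtain ⟨e, he0, he⟩ := NormedField.exists_norm_lt K
    (div_pos (pow_pos hε f.natDegree) (add_pos_of_nonneg_of_pos (norm_nonneg z) one_pos))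
  have he' : e ≠ 0 := norm_pos_iff.mp he0
  set q := Polynomial.C e * Polynomial.X with hq
  have hqdeg : q.degree < f.degree := by
    rw [hq, Polynomial.degree_C_mul_X he']
    rw [Polynomial.degree_eq_natDegree hmonic.ne_zero]
    exact_mod_cast hdeg
  set g := f + q with hg
  have hgmonic : g.Monic := hmonic.add_of_left hqdeg
  have hgdeg : g.natDegree = f.natDegree := Polynomial.natDegree_eq_of_degree_eq
    (Polynomial.degree_add_eq_left_of_degree_lt hqdeg)
  have hgsep : g.Separable := by
    refine ⟨0, Polynomial.C e⁻¹, ?_⟩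
    rw [hg, Polynomial.derivative_add, hder, hq, Polynomial.derivative_C_mul,
      Polynomial.derivative_X, zero_mul, zero_add, zero_add, mul_one, ← Polynomial.C_mul,
      inv_mul_cancel₀ he', Polynomial.C_1]
  by_contra! hfar
  set G := g.map (algebraMap K L) with hG
  have hsplit : G.Splits := IsAlgClosed.splits G
  have hroots : ∀ b ∈ G.roots, ε ≤ ‖z - b‖ := by
    intro b hb
    refine hfar b (hgsep.of_dvd (minpoly.dvd K b ?_))
    rw [← Polynomial.eval_map_algebraMap]
    exact (Polynomial.mem_roots'.mp hb).2
  have hcard : G.roots.card = f.natDegree := by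
    rw [← hsplit.natDegree_eq_card_roots, hG, Polynomial.natDegree_map, hgdeg]
  have heval : ‖G.eval z‖ = ‖e‖ * ‖z‖ := by
    rw [hG, Polynomial.eval_map_algebraMap, hg, map_add, hf, minpoly.aeval, hq]
    simp [norm_algebraMap']
  rw [hsplit.eval_eq_prod_roots_of_monic (hgmonic.map _)] at heval
  have hprod : ∀ m : Multiset L, (∀ b ∈ m, ε ≤ ‖z - b‖) →
      ε ^ m.card ≤ ‖(m.map fun b ↦ z - b).prod‖ := by
    intro m
    induction m using Multiset.induction_on with
    | empty => simp
    | cons b m ih =>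
      intro h
      rw [Multiset.card_cons, Multiset.map_cons, Multiset.prod_cons, norm_mul, pow_succ']
      exact mul_le_mul (h b (Multiset.mem_cons_self b m))
        (ih fun c hc ↦ h c (Multiset.mem_cons_of_mem hc)) (pow_nonneg hε.le _) (norm_nonneg _)
  have h1 := hprod _ hroots
  rw [heval, hcard] at h1
  rw [lt_div_iff₀ (add_pos_of_nonneg_of_pos (norm_nonneg z) one_pos)] at he
  nlinarith

theorem lt_norm_sub_of_norm_sub_le {A : Type*} [NormedField A] [IsUltrametricDist A]
    {a b a' b' : A} {r : ℝ} (hab : r < ‖a - b‖) (ha : ‖a' - a‖ ≤ r) (hb : ‖b' - b‖ ≤ r) :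
    r < ‖a' - b'‖ := by
  by_contra! h
  have h1 : a - b = -(a' - a) + ((a' - b') + (b' - b)) := by ring
  rw [h1] at hab
  refine absurd hab (not_lt.mpr ((IsUltrametricDist.norm_add_le_max _ _).trans (max_le ?_ ?_)))
  · rwa [norm_neg]
  · exact (IsUltrametricDist.norm_add_le_max _ _).trans (max_le h hb)

section Conjugates

variable {K A : Type*} [NontriviallyNormedField K] [NormedField A] [NormedAlgebra K A]
  [IsUltrametricDist K] [CompleteSpace K] [Algebra.IsAlgebraic K A] [IsUltrametricDist A]

/-- Inside a ball one can find a point with more separated conjugates, provided some nontrivial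
automorphism stabilises the ball. -/
theorem exists_more_separated_conjugates [IsAlgClosed A] {r r' : ℝ} (hr' : 0 < r') (hrr : r' < r)
    {x : A} (S : Finset (A ≃ₐ[K] A)) (hne : S.Nonempty)
    (hS : ∀ σ ∈ S, ∀ τ ∈ S, σ ≠ τ → r < ‖σ x - τ x‖)
    (hmove : ∃ σ : A ≃ₐ[K] A, σ ≠ 1 ∧ ‖σ x - x‖ ≤ r) :
    ∃ x' : A, ‖x' - x‖ ≤ r ∧ ∃ S' : Finset (A ≃ₐ[K] A), S'.card = S.card + 1 ∧
      ∀ σ ∈ S', ∀ τ ∈ S', σ ≠ τ → r' < ‖σ x' - τ x'‖ := by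
  classical
  obtain ⟨h, h1, hx⟩ := hmove
  obtain ⟨x', hx', hhx'⟩ : ∃ x' : A, ‖x' - x‖ ≤ r ∧ r' < ‖h x' - x'‖ := by
    by_cases hcase : r' < ‖h x - x‖
    · exact ⟨x, by simpa using (hr'.trans hrr).le, hcase⟩
    obtain ⟨u, hu, hhu⟩ : ∃ u, ‖u‖ ≤ r ∧ r' < ‖h u - u‖ := by
      by_contra! hcon
      exact h1 (algEquiv_eq_one_of_norm_sub_le h hr' hrr hcon)
    refine ⟨x + u, by simpa using hu, ?_⟩
    by_contra! hle
    have h2 : h u - u = (h (x + u) - (x + u)) + -(h x - x) := by rw [map_add]; ring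
    rw [h2] at hhu
    refine absurd hhu (not_lt.mpr ((IsUltrametricDist.norm_add_le_max _ _).trans (max_le hle ?_)))
    rw [norm_neg]
    exact not_lt.mp hcase
  obtain ⟨σ₀, hσ₀⟩ := hne
  have hclose : ∀ σ : A ≃ₐ[K] A, ‖σ x' - σ x‖ ≤ r := fun σ ↦ by
    rwa [← map_sub, norm_algEquiv_apply]
  have hclose' : ‖(σ₀ * h) x' - σ₀ x‖ ≤ r := by
    rw [AlgEquiv.mul_apply, ← map_sub, norm_algEquiv_apply]
    have : h x' - x = h (x' - x) + (h x - x) := by rw [map_sub]; ring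
    rw [this]
    refine (IsUltrametricDist.norm_add_le_max _ _).trans (max_le ?_ hx)
    rwa [norm_algEquiv_apply]
  have hnew : ∀ τ ∈ S, r' < ‖(σ₀ * h) x' - τ x'‖ := by
    intro τ hτ
    by_cases hcase : σ₀ = τ
    · rwa [← hcase, AlgEquiv.mul_apply, ← map_sub, norm_algEquiv_apply]
    · exact hrr.trans (lt_norm_sub_of_norm_sub_le (hS σ₀ hσ₀ τ hτ hcase) hclose' (hclose τ))
  have hnotin : σ₀ * h ∉ S := by
    intro hmem
    have := hnew _ hmem
    rw [sub_self, norm_zero] at this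
    exact lt_asymm this hr'
  refine ⟨x', hx', insert (σ₀ * h) S, Finset.card_insert_of_notMem hnotin, ?_⟩
  intro σ hσ τ hτ hne
  rcases Finset.mem_insert.mp hσ with rfl | hσ <;> rcases Finset.mem_insert.mp hτ with rfl | hτ
  · exact absurd rfl hne
  · exact hnew τ hτ
  · rw [norm_sub_rev]; exact hnew σ hσ
  · exact hrr.trans (lt_norm_sub_of_norm_sub_le (hS σ hσ τ hτ hne) (hclose σ) (hclose τ))

theorem card_le_natDegree_minpoly_of_separated {x y : A} {r : ℝ} (hr : 0 < r) (hxy : ‖y - x‖ ≤ r)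
    (S : Finset (A ≃ₐ[K] A)) (hS : ∀ σ ∈ S, ∀ τ ∈ S, σ ≠ τ → r < ‖σ x - τ x‖) :
    S.card ≤ (minpoly K y).natDegree := by
  classical
  have hclose : ∀ σ : A ≃ₐ[K] A, ‖σ y - σ x‖ ≤ r := fun σ ↦ by
    rwa [← map_sub, norm_algEquiv_apply]
  have hinj : Set.InjOn (fun σ : A ≃ₐ[K] A ↦ σ y) S := by
    intro σ hσ τ hτ heq
    by_contra hne
    have := lt_norm_sub_of_norm_sub_le (hS σ hσ τ hτ hne) (hclose σ) (hclose τ)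
    rw [show σ y = τ y from heq, sub_self, norm_zero] at this
    exact lt_asymm this hr
  rw [← Finset.card_image_of_injOn hinj]
  refine (Finset.card_le_card (t := ((minpoly K y).aroots A).toFinset) ?_).trans
    ((Multiset.toFinset_card_le _).trans ?_)
  · intro t ht
    obtain ⟨σ, -, rfl⟩ := Finset.mem_image.mp ht
    rw [Multiset.mem_toFinset, Polynomial.mem_aroots]
    refine ⟨minpoly.ne_zero (Algebra.IsIntegral.isIntegral y), ?_⟩
    rw [Polynomial.aeval_algHom_apply, minpoly.aeval, map_zero]
  · exact (Polynomial.card_roots' _).trans Polynomial.natDegree_map_le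

/-- If every ball around every point is stabilised by a nontrivial automorphism, there is a
decreasing sequence of balls, with radii bounded below by `1`, meeting in no algebraic point. -/
theorem exists_nested_balls_avoiding [IsAlgClosed A]
    (hmove : ∀ (x : A) (r : ℝ), 0 < r → ∃ σ : A ≃ₐ[K] A, σ ≠ 1 ∧ ‖σ x - x‖ ≤ r) :
    ∃ a : ℕ → A, (∀ n : ℕ, ‖a (n + 1) - a n‖ ≤ 1 + 1 / ((n : ℝ) + 1)) ∧
      ∀ y : A, ∃ n : ℕ, 1 + 1 / ((n : ℝ) + 1) < ‖y - a n‖ := by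
  let r : ℕ → ℝ := fun n ↦ 1 + 1 / ((n : ℝ) + 1)
  have hr : ∀ n, 0 < r n := fun n ↦ add_pos one_pos Nat.one_div_pos_of_nat
  have hrr : ∀ n, r (n + 1) < r n := fun n ↦
    add_lt_add_right (Nat.one_div_lt_one_div n.lt_succ_self) 1
  let P : ℕ → A → Prop := fun n x ↦ ∃ S : Finset (A ≃ₐ[K] A), S.card = n + 1 ∧
    ∀ σ ∈ S, ∀ τ ∈ S, σ ≠ τ → r n < ‖σ x - τ x‖
  have hP0 : P 0 0 := ⟨{1}, by simp, by simp⟩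
  have hstep : ∀ n x, P n x → ∃ x', ‖x' - x‖ ≤ r n ∧ P (n + 1) x' := by
    rintro n x ⟨S, hcard, hS⟩
    obtain ⟨x', hx', S', hcard', hS'⟩ := exists_more_separated_conjugates (hr (n + 1)) (hrr n) S
      (Finset.card_pos.mp (by lia)) hS (hmove x (r n) (hr n))
    exact ⟨x', hx', S', by lia, hS'⟩
  choose f hf hPf using hstep
  let a : ∀ n, {x // P n x} := fun n ↦
    Nat.rec ⟨0, hP0⟩ (fun n x ↦ ⟨f n x.1 x.2, hPf n x.1 x.2⟩) n
  refine ⟨fun n ↦ (a n).1, fun n ↦ hf n (a n).1 (a n).2, fun y ↦ ?_⟩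
  by_contra! hy
  obtain ⟨S, hcard, hS⟩ := (a (minpoly K y).natDegree).2
  have := card_le_natDegree_minpoly_of_separated (hr _) (hy _) S hS
  lia

end Conjugates

open IntermediateField in
/-- A spherically complete completed algebraic closure of a nontrivially normed complete field is
a finite extension. -/
theorem finiteDimensional_of_sphericallyComplete {K L : Type*} [NontriviallyNormedField K]
    [NormedField L] [NormedAlgebra K L] [CompleteSpace K] [IsUltrametricDist K]
    [IsUltrametricDist L] [IsAlgClosed L]
    (hdense : Dense {z : L | IsAlgebraic K z})
    (h_sph : ∀ (a : ℕ → L) (r : ℕ → ℝ), (∀ n, 0 < r n) →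
      (∀ n, Metric.closedBall (a (n + 1)) (r (n + 1)) ⊆ Metric.closedBall (a n) (r n)) →
      (⋂ n, Metric.closedBall (a n) (r n)).Nonempty) :
    FiniteDimensional K L := by
  let A := algebraicClosure K L
  have hA : IsAlgClosed A := IsAlgClosure.isAlgClosed K
  obtain ⟨x, r, hr, hx⟩ : ∃ (x : A) (r : ℝ), 0 < r ∧ ∀ σ : A ≃ₐ[K] A, ‖σ x - x‖ ≤ r → σ = 1 := by
    by_contra! hcon
    obtain ⟨a, ha, hay⟩ := exists_nested_balls_avoiding (K := K) (A := A) fun x r hr ↦ by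
      obtain ⟨σ, h1, h2⟩ := hcon x r hr
      exact ⟨σ, h2, h1⟩
    have hpos : ∀ n : ℕ, (0 : ℝ) < 1 / (n + 1) := fun n ↦ Nat.one_div_pos_of_nat
    obtain ⟨c, hc⟩ := h_sph (fun n ↦ (a n : L)) (fun n ↦ 1 + 1 / ((n : ℝ) + 1))
      (fun n ↦ add_pos one_pos (hpos n)) (fun n z hz ↦ by
        rw [mem_closedBall_iff_norm] at hz ⊢
        have : z - a n = (z - a (n + 1)) + (a (n + 1) - a n) := by ring
        rw [this]
        refine (IsUltrametricDist.norm_add_le_max _ _).trans (max_le (hz.trans ?_) (ha n))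
        exact add_le_add_right (Nat.one_div_le_one_div n.le_succ) 1)
    obtain ⟨y, hy, hyc⟩ := hdense.exists_dist_lt c one_pos
    obtain ⟨n, hn⟩ := hay ⟨y, mem_algebraicClosure_iff.mpr hy⟩
    refine absurd hn (not_lt.mpr ?_)
    change ‖y - a n‖ ≤ _
    have hcn := Set.mem_iInter.mp hc n
    rw [mem_closedBall_iff_norm] at hcn
    have : y - a n = (y - c) + (c - a n) := by ring
    rw [this]
    refine (IsUltrametricDist.norm_add_le_max _ _).trans (max_le ?_ hcn)
    rw [← dist_eq_norm, dist_comm]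
    linarith [hpos n]
  have hxint : IsIntegral K (x : L) := (mem_algebraicClosure_iff.mp x.2).isIntegral
  have hfd : FiniteDimensional K K⟮(x : L)⟯ := adjoin.finiteDimensional hxint
  have hsep : ∀ s : L, IsSeparable K s → s ∈ K⟮(x : L)⟯ := by
    intro s hs
    have hsA : s ∈ A := mem_algebraicClosure_iff.mpr (IsSeparable.isIntegral hs).isAlgebraic
    have hs' : IsSeparable K (⟨s, hsA⟩ : A) :=
      (isSeparable_map_iff A.val A.val.injective).mp hs
    have hmem : (⟨s, hsA⟩ : A) ∈ K⟮x⟯ := mem_adjoin_of_forall_algEquiv_eq_one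
      (fun σ hσ ↦ hx σ (by simpa [hσ] using hr.le)) hs'
    have hmap := IntermediateField.adjoin_map K {x} A.val
    rw [Set.image_singleton] at hmap
    change s ∈ adjoin K {A.val x}
    rw [← hmap]
    exact ⟨_, hmem, rfl⟩
  have hclosed : IsClosed (K⟮(x : L)⟯ : Set L) :=
    Submodule.closed_of_finiteDimensional (K⟮(x : L)⟯).toSubmodule
  have htop : K⟮(x : L)⟯ = ⊤ := by
    refine eq_top_iff.mpr fun z _ ↦ ?_
    change z ∈ (K⟮(x : L)⟯ : Set L)
    rw [← hclosed.closure_eq, Metric.mem_closure_iff]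
    intro ε hε
    obtain ⟨y, hy, hyz⟩ := hdense.exists_dist_lt z (half_pos hε)
    obtain ⟨s, hs, hys⟩ := exists_isSeparable_norm_sub_lt hy.isIntegral (half_pos hε)
    refine ⟨s, hsep s hs, (dist_triangle z y s).trans_lt ?_⟩
    rw [dist_eq_norm y s]
    linarith
  rw [htop] at hfd
  exact LinearEquiv.finiteDimensional (topEquiv (F := K) (E := L)).toLinearEquiv

/-- Over a field all of whose elements have norm at most `1`, integral elements have norm at
most `1`. -/
theorem IsIntegral.norm_le_one_of_forall_norm_le_one {K L : Type*} [NormedField K] [NormedField L]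
    [NormedAlgebra K L] [IsUltrametricDist L] (hK : ∀ c : K, ‖c‖ ≤ 1) {x : L}
    (hx : IsIntegral K x) : ‖x‖ ≤ 1 := by
  by_contra! h
  have hmonic := minpoly.monic hx
  obtain ⟨m, hm⟩ := Nat.exists_eq_succ_of_ne_zero (minpoly.natDegree_pos hx).ne'
  have h0 : x ^ (minpoly K x).natDegree +
      ∑ i ∈ Finset.range (minpoly K x).natDegree, algebraMap K L ((minpoly K x).coeff i) * x ^ i
        = 0 := by
    have h1 := minpoly.aeval K x
    rw [Polynomial.aeval_eq_sum_range, Finset.sum_range_succ, hmonic.coeff_natDegree, one_smul,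
      add_comm] at h1
    simpa only [Algebra.smul_def] using h1
  have hbound : ‖x ^ (minpoly K x).natDegree‖ ≤ ‖x‖ ^ m := by
    rw [eq_neg_of_add_eq_zero_left h0, norm_neg]
    refine IsUltrametricDist.norm_sum_le_of_forall_le_of_nonneg (by positivity) fun i hi ↦ ?_
    rw [norm_mul, norm_pow, norm_algebraMap']
    have him : i ≤ m := by
      have := Finset.mem_range.mp hi
      omega
    calc ‖(minpoly K x).coeff i‖ * ‖x‖ ^ i ≤ 1 * ‖x‖ ^ i :=
          mul_le_mul_of_nonneg_right (hK _) (by positivity)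
      _ ≤ ‖x‖ ^ m := by
          rw [one_mul]
          exact pow_le_pow_right₀ h.le him
  rw [norm_pow, hm] at hbound
  exact absurd hbound (not_le.mpr (pow_lt_pow_right₀ h (Nat.lt_succ_self m)))

/-- A linear functional normalised at `1` on an extension of fields. -/
theorem exists_linearMap_one_eq_one (K L : Type*) [Field K] [Field L] [Algebra K L] :
    ∃ lam : L →ₗ[K] K, lam 1 = 1 := by
  obtain ⟨g, hg⟩ := LinearMap.exists_leftInverse_of_injective (Algebra.linearMap K L)
    (LinearMap.ker_eq_bot.mpr (algebraMap K L).injective)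
  refine ⟨g, ?_⟩
  simpa using LinearMap.congr_fun hg 1

/-- A finite-dimensional normed field extension of a complete nontrivially normed field is algebraic
and carries a bounded linear functional with value `1` at `1`. -/
theorem isAlgebraic_and_exists_bounded_functional_of_finiteDimensional {K L : Type*}
    [NontriviallyNormedField K] [NormedField L] [NormedAlgebra K L] [CompleteSpace K]
    [FiniteDimensional K L] :
    Algebra.IsAlgebraic K L ∧ ∃ lam : L →ₗ[K] K, lam 1 = 1 ∧ ∃ M : ℝ, 0 < M ∧
      ∀ c, ‖lam c‖ ≤ M * ‖c‖ := by
  refine ⟨inferInstance, ?_⟩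
  obtain ⟨lam, hlam⟩ := exists_linearMap_one_eq_one K L
  refine ⟨lam, hlam, ‖LinearMap.toContinuousLinearMap lam‖ + 1, by positivity, fun c ↦ ?_⟩
  have h := (LinearMap.toContinuousLinearMap lam).le_opNorm c
  rw [LinearMap.coe_toContinuousLinearMap'] at h
  exact h.trans (mul_le_mul_of_nonneg_right (by linarith) (norm_nonneg _))

/-- The same conclusion when the norm of `K` is trivial and the algebraic elements are dense. -/
theorem isAlgebraic_and_exists_bounded_functional_of_forall_norm_le_one {K L : Type*}
    [NormedField K] [NormedField L] [NormedAlgebra K L] [IsUltrametricDist L]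
    (hK : ∀ c : K, ‖c‖ ≤ 1) (hdense : Dense {z : L | IsAlgebraic K z}) :
    Algebra.IsAlgebraic K L ∧ ∃ lam : L →ₗ[K] K, lam 1 = 1 ∧ ∃ M : ℝ, 0 < M ∧
      ∀ c, ‖lam c‖ ≤ M * ‖c‖ := by
  have hone : ∀ x : L, IsAlgebraic K x → x ≠ 0 → 1 ≤ ‖x‖ := by
    intro x hx hx0
    have h := hx.inv.isIntegral.norm_le_one_of_forall_norm_le_one hK
    rw [norm_inv] at h
    exact (inv_le_one₀ (norm_pos_iff.mpr hx0)).mp h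
  have halg : ∀ z : L, IsAlgebraic K z := by
    intro z
    obtain ⟨s, hs, hzs⟩ := Metric.dense_iff.mp hdense z 1 one_pos
    rw [Metric.mem_ball, dist_comm, dist_eq_norm] at hs
    suffices z = s by rwa [this]
    by_contra hne
    have hpos : 0 < ‖z - s‖ := norm_pos_iff.mpr (sub_ne_zero.mpr hne)
    obtain ⟨t, ht, hzt⟩ := Metric.dense_iff.mp hdense z ‖z - s‖ hpos
    rw [Metric.mem_ball, dist_eq_norm] at ht
    have hst : t = s := by
      by_contra hts
      have h1 := hone (t - s) (IsAlgebraic.sub hzt hzs) (sub_ne_zero.mpr hts)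
      have h2 := IsUltrametricDist.norm_add_le_max (t - z) (z - s)
      rw [sub_add_sub_cancel] at h2
      exact absurd (h1.trans h2) (not_le.mpr (max_lt (ht.trans hs) hs))
    rw [hst, norm_sub_rev] at ht
    exact lt_irrefl _ ht
  refine ⟨⟨halg⟩, ?_⟩
  obtain ⟨lam, hlam⟩ := exists_linearMap_one_eq_one K L
  refine ⟨lam, hlam, 1, one_pos, fun c ↦ ?_⟩
  rw [one_mul]
  rcases eq_or_ne c 0 with rfl | hc
  · simp
  · exact (hK _).trans (hone c (halg c) hc)

/-- A spherically complete, algebraically closed nonarchimedean field in which the elements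
algebraic over a complete subfield `K` are dense is algebraic over `K` and carries a bounded
`K`-linear functional with value `1` at `1`. -/
theorem isAlgebraic_and_exists_bounded_functional {K L : Type*} [NormedField K] [NormedField L]
    [NormedAlgebra K L] [CompleteSpace K] [IsUltrametricDist K] [IsUltrametricDist L]
    [IsAlgClosed L] (hdense : Dense {z : L | IsAlgebraic K z})
    (h_sph : ∀ (a : ℕ → L) (r : ℕ → ℝ), (∀ n, 0 < r n) →
      (∀ n, Metric.closedBall (a (n + 1)) (r (n + 1)) ⊆ Metric.closedBall (a n) (r n)) →
      (⋂ n, Metric.closedBall (a n) (r n)).Nonempty) :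
    Algebra.IsAlgebraic K L ∧ ∃ lam : L →ₗ[K] K, lam 1 = 1 ∧ ∃ M : ℝ, 0 < M ∧
      ∀ c, ‖lam c‖ ≤ M * ‖c‖ := by
  by_cases hK : ∀ c : K, ‖c‖ ≤ 1
  · exact isAlgebraic_and_exists_bounded_functional_of_forall_norm_le_one hK hdense
  · push Not at hK
    let : NontriviallyNormedField K := { ‹NormedField K› with non_trivial := hK }
    have : FiniteDimensional K L := finiteDimensional_of_sphericallyComplete hdense h_sph
    exact isAlgebraic_and_exists_bounded_functional_of_finiteDimensional


/-- Let `K` be a complete nonarchimedean normed field and `C` a complete,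
algebraically closed nonarchimedean normed field with an isometric embedding `i : K → C` whose
algebraic points are dense (so `C` is a completed algebraic closure of `K`).  If `C` is
spherically complete, then there is no topologically simple nonarchimedean ring norm on `K[T]`
restricting to the norm of `K` on constants: every such norm has a nonzero, non-dense ideal. -/
theorem stmt_9 {K C : Type*} [NormedField K] [NormedField C]
    [CompleteSpace K] [CompleteSpace C] [IsAlgClosed C]
    (hK : ∀ x y : K, ‖x + y‖ ≤ max ‖x‖ ‖y‖)
    (hC : ∀ x y : C, ‖x + y‖ ≤ max ‖x‖ ‖y‖)
    (i : K →+* C) (hi : ∀ x : K, ‖i x‖ = ‖x‖)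
    (h_alg_dense :
      Dense {z : C | ∃ p : Polynomial K, p ≠ 0 ∧ Polynomial.eval z (Polynomial.map i p) = 0})
    (h_sph : ∀ (a : ℕ → C) (r : ℕ → ℝ), (∀ n, 0 < r n) →
      (∀ n, Metric.closedBall (a (n + 1)) (r (n + 1)) ⊆ Metric.closedBall (a n) (r n)) →
      (⋂ n, Metric.closedBall (a n) (r n)).Nonempty)
    (v : Polynomial K → ℝ)
    (hv_nonneg : ∀ f, 0 ≤ v f) (hv_zero : v 0 = 0) (hv_one : v 1 = 1)
    (hv_add : ∀ f g, v (f + g) ≤ max (v f) (v g))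
    (hv_mul : ∀ f g, v (f * g) ≤ v f * v g)
    (hv_def : ∀ f, v f = 0 → f = 0)
    (hv_K : ∀ c : K, v (Polynomial.C c) = ‖c‖) :
    ∃ I : Ideal (Polynomial K), I ≠ ⊥ ∧
      ∃ (g : Polynomial K) (ε : ℝ), 0 < ε ∧ ∀ h ∈ I, ε ≤ v (g - h) := by
  have : IsUltrametricDist K := IsUltrametricDist.isUltrametricDist_of_forall_norm_add_le_max_norm hK
  have : IsUltrametricDist C := IsUltrametricDist.isUltrametricDist_of_forall_norm_add_le_max_norm hC
  let : NormedAlgebra K C :=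
    { i.toAlgebra with
      norm_smul_le := fun c x ↦ by
        rw [← hi c, ← norm_mul]
        exact le_rfl }
  have hmap : algebraMap K C = i := rfl
  have hdense : Dense {z : C | IsAlgebraic K z} := by
    refine h_alg_dense.mono ?_
    rintro z ⟨p, hp, hz⟩
    exact ⟨p, hp, by rwa [← Polynomial.eval_map_algebraMap]⟩
  obtain ⟨halg, lam, hlam1, M, hM, hlam⟩ :=
    isAlgebraic_and_exists_bounded_functional hdense h_sph
  have hneg_le : ∀ f, v (-f) ≤ v f := by
    intro f
    have h := hv_mul (Polynomial.C (-1)) f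
    rw [hv_K, norm_neg, norm_one, one_mul] at h
    simpa using h
  let V : RingSeminorm (Polynomial K) :=
    { toFun := v
      map_zero' := hv_zero
      add_le' := fun f g ↦ (hv_add f g).trans
        (max_le_add_of_nonneg (hv_nonneg f) (hv_nonneg g))
      neg' := fun f ↦ le_antisymm (hneg_le f) (by simpa using hneg_le (-f))
      mul_le' := hv_mul }
  obtain ⟨μ, hμ1, hμna, hμC, hμv⟩ :=
    exists_ringSeminorm_extension lam hlam1 M hM hlam V hv_one hv_add hv_K
  obtain ⟨w, hwna, hw1, hwmul, hwμ⟩ := exists_multiplicative_seminorm_le μ hμ1 hμna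
  obtain ⟨a, ha⟩ := exists_norm_eval_le h_sph hC w hwna hw1 hwmul
    fun c ↦ (hwμ _).trans (hμC c)
  have hva : ∀ f : Polynomial K, ‖(f.map i).eval a‖ ≤ v f := fun f ↦
    (ha _).trans ((hwμ _).trans (hμv f))
  obtain ⟨p, hp, hpa⟩ := halg.isAlgebraic a
  rw [← Polynomial.eval_map_algebraMap, hmap] at hpa
  refine ⟨Ideal.span {p}, by simpa using hp, 1, 1, one_pos, fun h hh ↦ ?_⟩
  obtain ⟨q, rfl⟩ := Ideal.mem_span_singleton'.mp hh
  simpa [hpa] using hva (1 - q * p)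
end

section
/- Let M be a complete nonarchimedean normed field, let L be a dense subfield of M, and let K be a subfield of M contained in L such that L is a finite-dimensional K-vector space. Then M is a finite-dimensional vector space over the topological closure of K in M. (Equivalently: the completion of a finite extension L of a valued field K, with respect to an absolute value on L, is a finite extension of the completion of K.) -/
/-- A subfield of a normed field whose elements have bounded norm carries the trivial norm. -/
theorem Subfield.norm_eq_one_of_bounded {M : Type*} [NormedField M] (L : Subfield M) {C : ℝ}
    (hC : ∀ y ∈ L, ‖y‖ ≤ C) {y : M} (hy : y ∈ L) (hy0 : y ≠ 0) : ‖y‖ = 1 := by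
  have le_one : ∀ z ∈ L, ‖z‖ ≤ 1 := by
    intro z hz
    by_contra! h
    obtain ⟨n, hn⟩ := pow_unbounded_of_one_lt C h
    exact absurd (hC _ (pow_mem hz n)) (by rw [norm_pow]; exact not_le.2 hn)
  refine le_antisymm (le_one y hy) ?_
  have h := le_one _ (inv_mem hy)
  rw [norm_inv] at h
  exact (inv_le_one₀ (norm_pos_iff.2 hy0)).1 h

/-- A subfield of a normed field whose elements have bounded norm is closed. -/
theorem Subfield.isClosed_of_bounded {M : Type*} [NormedField M] (L : Subfield M) {C : ℝ}
    (hC : ∀ y ∈ L, ‖y‖ ≤ C) : IsClosed (L : Set M) := by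
  refine isClosed_of_closure_subset fun x hx => ?_
  rw [Metric.mem_closure_iff] at hx
  obtain ⟨y, hy, hxy⟩ := hx (1 / 2) (by norm_num)
  by_contra hxL
  have hne : x ≠ y := fun h => hxL (h ▸ hy)
  obtain ⟨z, hz, hxz⟩ := hx (min (1 / 2) (dist x y)) (lt_min (by norm_num) (dist_pos.2 hne))
  rw [lt_min_iff] at hxz
  have hyz : y - z ≠ 0 := by
    rw [sub_ne_zero]
    rintro rfl
    exact lt_irrefl _ hxz.2
  have h1 := L.norm_eq_one_of_bounded hC (sub_mem hy hz) hyz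
  rw [← dist_eq_norm] at h1
  have h2 := dist_triangle_left y z x
  linarith [hxz.1]

/-- Over a subfield with elements of norm at most one, a finite set has bounded span. -/
theorem Subfield.norm_le_of_mem_span {M : Type*} [NormedField M] (K : Subfield M)
    (hK : ∀ a ∈ K, ‖a‖ ≤ 1) (s : Finset M) {y : M}
    (hy : y ∈ Submodule.span K (s : Set M)) : ‖y‖ ≤ ∑ v ∈ s, ‖v‖ := by
  obtain ⟨f, -, rfl⟩ := Submodule.mem_span_finset.1 hy
  refine norm_sum_le_of_le _ fun v _ => ?_
  rw [Subfield.smul_def, smul_eq_mul, norm_mul]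
  exact mul_le_of_le_one_left (norm_nonneg v) (hK _ (f v).2)

/-- In a normed field, the span of a finite set over a complete nontrivially normed subfield is
closed. -/
theorem Subfield.isClosed_span_finset {M : Type*} [NormedField M] (F : Subfield M)
    [CompleteSpace F] (hF : ∃ a ∈ F, 1 < ‖a‖) (s : Finset M) :
    IsClosed (Submodule.span F (s : Set M) : Set M) := by
  let : NontriviallyNormedField F :=
    { SubfieldClass.toNormedField F with
      non_trivial := by
        obtain ⟨a, ha, h⟩ := hF
        exact ⟨⟨a, ha⟩, h⟩ }
  have : ContinuousSMul F M :=
    ⟨(continuous_subtype_val.comp continuous_fst).mul continuous_snd⟩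
  have : FiniteDimensional F (Submodule.span F (s : Set M)) :=
    FiniteDimensional.span_finset F s
  exact Submodule.closed_of_finiteDimensional (𝕜 := F) _

/-- Let `M` be a complete nonarchimedean normed field, `L` a dense subfield of `M`,
and `K` a subfield of `M` contained in `L` such that `L` is a finite-dimensional `K`-vector space
(i.e. `L` is spanned over `K` by a finite set).  Then `M` is a finite-dimensional vector space
over the topological closure of `K` in `M`. -/
theorem stmt_10 {M : Type*} [NormedField M] [CompleteSpace M]
    (hM : ∀ x y : M, ‖x + y‖ ≤ max ‖x‖ ‖y‖)
    (K L : Subfield M) (hKL : K ≤ L) (h_dense : Dense (L : Set M))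
    (h_fin : ∃ s : Finset M, (↑s : Set M) ⊆ (L : Set M) ∧
      (L : Set M) ⊆ (Submodule.span K (↑s : Set M) : Submodule K M)) :
    ∃ t : Finset M, ∀ x : M,
      x ∈ Submodule.span K.topologicalClosure (↑t : Set M) := by
  obtain ⟨s, -, hs⟩ := h_fin
  refine ⟨s, fun x => ?_⟩
  have hspan : (L : Set M) ⊆ Submodule.span K.topologicalClosure (s : Set M) := by
    intro y hy
    obtain ⟨f, -, rfl⟩ := Submodule.mem_span_finset.1 (hs hy)
    refine Submodule.sum_mem _ fun v hv => ?_
    exact Submodule.smul_mem _ (⟨f v, K.le_topologicalClosure (f v).2⟩ : K.topologicalClosure)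
      (Submodule.subset_span hv)
  by_cases hK : ∃ a ∈ K, 1 < ‖a‖
  · obtain ⟨a, ha, h⟩ := hK
    have : CompleteSpace K.topologicalClosure :=
      K.isClosed_topologicalClosure.completeSpace_coe
    have hcl := K.topologicalClosure.isClosed_span_finset
      ⟨a, K.le_topologicalClosure ha, h⟩ s
    exact closure_minimal hspan hcl (h_dense x)
  · push Not at hK
    have hL := L.isClosed_of_bounded fun y hy => K.norm_le_of_mem_span hK s (hs hy)
    exact hspan (closure_minimal subset_rfl hL (h_dense x))
end

section
/- Let ι be an additive commutative monoid and let A and B be commutative rings graded by families of additive subgroups (𝒜_i)_{i∈ι} and (ℬ_i)_{i∈ι}. Assume A and B are graded integral domains, i.e. every nonzero homogeneous element is a non-zero-divisor. Let φ : A → B be an injective graded ring homomorphism (φ(𝒜_i) ⊆ ℬ_i for all i) such that B is integral over A. Then every nonzero homogeneous ideal of B contracts to a nonzero ideal of A: if J is a homogeneous ideal of B with J ≠ 0, then φ⁻¹(J) ≠ 0. -/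
/-- Let `A` and `B` be commutative rings graded by an additive commutative monoid
`ι` (gradings by families of additive subgroups), both graded integral domains (every nonzero
homogeneous element is a non-zero-divisor).  Let `φ : A → B` be an injective graded ring
homomorphism making `B` integral over `A`.  Then every nonzero homogeneous ideal of `B` contracts
to a nonzero ideal of `A`. -/
theorem stmt_11 {ι : Type*} [AddCommMonoid ι] [DecidableEq ι]
    {A B : Type*} [CommRing A] [CommRing B]
    (𝒜 : ι → AddSubgroup A) (ℬ : ι → AddSubgroup B)
    [GradedRing 𝒜] [GradedRing ℬ]
    (hA : ∀ (i : ι) (a : A), a ∈ 𝒜 i → a ≠ 0 → ∀ b : A, a * b = 0 → b = 0)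
    (hB : ∀ (i : ι) (b : B), b ∈ ℬ i → b ≠ 0 → ∀ c : B, b * c = 0 → c = 0)
    (φ : A →+* B) (h_inj : Function.Injective φ)
    (h_graded : ∀ i : ι, ∀ a ∈ 𝒜 i, φ a ∈ ℬ i)
    (h_int : φ.IsIntegral) :
    ∀ J : Ideal B, Ideal.IsHomogeneous ℬ J → J ≠ ⊥ → Ideal.comap φ J ≠ ⊥ := by
  intro J hJ hJ_ne h_bot
  obtain ⟨x, hxJ, hx⟩ := Submodule.exists_mem_ne_zero_of_ne_bot hJ_ne
  obtain ⟨i, hi⟩ : ∃ i, (DirectSum.decompose ℬ x i : B) ≠ 0 := by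
    by_contra! h
    exact hx ((DirectSum.decompose ℬ).injective (by ext i; simp [h i]))
  let b : B := (DirectSum.decompose ℬ x i : B)
  have hbJ : b ∈ J := hJ i hxJ
  have hb_reg : ∀ c : B, c * b = 0 → c = 0 := fun c hc =>
    hB i b (DirectSum.decompose ℬ x i).2 hi c (by rwa [mul_comm])
  have : Nontrivial B := ⟨x, 0, hx⟩
  have : Nontrivial A := φ.domain_nontrivial
  obtain ⟨p, hp, hpb⟩ := h_int b
  obtain ⟨n, hn, hnJ⟩ := Ideal.exists_coeff_ne_zero_mem_comap_of_non_zero_divisor_root_mem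
    (fun {c} => hb_reg c) hbJ hp.ne_zero hpb
  rw [h_bot] at hnJ
  exact hn hnJ
end

section
/- Let ι be an additive commutative monoid and let A and B be commutative rings graded by families of additive subgroups (𝒜_i)_{i∈ι} and (ℬ_i)_{i∈ι}. Call a homogeneous ideal 𝔭 of A graded prime if 𝔭 ≠ A and for every homogeneous element x ∉ 𝔭 and every b ∈ A, x·b ∈ 𝔭 implies b ∈ 𝔭 (i.e. the quotient A/𝔭 is a graded integral domain); define graded prime homogeneous ideals of B analogously. Let φ : A → B be a graded ring homomorphism (φ(𝒜_i) ⊆ ℬ_i) such that B is integral over A, let 𝔭 be a graded prime homogeneous ideal of A, and let 𝔮 be a graded prime homogeneous ideal of B with φ⁻¹(𝔮) = 𝔭. Then no homogeneous ideal of B strictly containing 𝔮 contracts to 𝔭: for every homogeneous ideal J of B with 𝔮 ⊊ J, one has φ⁻¹(J) ≠ 𝔭. -/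
/-- A homogeneous ideal that is not contained in `I` has a homogeneous element
outside `I`. -/
theorem Ideal.IsHomogeneous.exists_homogeneous_mem_notMem {ι σ R : Type*} [DecidableEq ι]
    [AddMonoid ι] [Semiring R] [SetLike σ R] [AddSubmonoidClass σ R] {𝒜 : ι → σ} [GradedRing 𝒜]
    {I J : Ideal R} (hJ : J.IsHomogeneous 𝒜) (h : ¬ J ≤ I) :
    ∃ i, ∃ y ∈ 𝒜 i, y ∈ J ∧ y ∉ I := by
  classical
  by_contra! H
  refine h fun x hx => ?_
  rw [← DirectSum.sum_support_decompose 𝒜 x]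
  exact I.sum_mem fun i _ => H i _ (SetLike.coe_mem _) (hJ i hx)

/-- If `y ∈ J` is a non-zero-divisor modulo a proper ideal `I ≤ J` and is a root modulo `I` of a
monic polynomial over `A`, then `I` and `J` have distinct contractions to `A`. -/
theorem Ideal.comap_ne_comap_of_monic_eval₂_mem {A B : Type*} [CommRing A] [CommRing B]
    (φ : A →+* B) {I J : Ideal B} (hI : I ≠ ⊤) (hIJ : I ≤ J) {y : B} (hy : y ∈ J)
    (hreg : ∀ b : B, y * b ∈ I → b ∈ I) {f : Polynomial A} (hf : f.Monic)
    (hfy : f.eval₂ φ y ∈ I) : J.comap φ ≠ I.comap φ := by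
  intro hcomap
  induction hn : f.natDegree generalizing f with
  | zero =>
    rw [Polynomial.eq_one_of_monic_natDegree_zero hf hn, Polynomial.eval₂_one] at hfy
    exact hI ((Ideal.eq_top_iff_one I).2 hfy)
  | succ n ih =>
    have heval : y * f.divX.eval₂ φ y + φ (f.coeff 0) = f.eval₂ φ y := by
      conv_rhs => rw [← Polynomial.X_mul_divX_add f, Polynomial.eval₂_add, Polynomial.eval₂_mul,
        Polynomial.eval₂_X, Polynomial.eval₂_C]
    have hcoeff : f.coeff 0 ∈ I.comap φ := by
      rw [← hcomap, Ideal.mem_comap, ← Ideal.add_mem_iff_right J (J.mul_mem_right _ hy), heval]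
      exact hIJ hfy
    have hdeg : f.divX.natDegree = n := by
      rw [Polynomial.natDegree_divX_eq_natDegree_tsub_one, hn, Nat.add_sub_cancel]
    refine ih (f := f.divX) ?_ (hreg _ ?_) hdeg
    · rw [Polynomial.Monic, Polynomial.leadingCoeff, hdeg, Polynomial.coeff_divX, ← hn]
      exact hf
    · rwa [← Ideal.add_mem_iff_left I hcoeff, heval]

/-- graded incomparability: Let `A` and `B` be commutative rings graded by an
additive commutative monoid `ι`, `φ : A → B` a graded ring homomorphism making `B` integral over
`A`, `𝔭` a graded prime homogeneous ideal of `A` and `𝔮` a graded prime homogeneous ideal of `B`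
with `φ⁻¹(𝔮) = 𝔭`.  Then no homogeneous ideal of `B` strictly containing `𝔮` contracts to `𝔭`. -/
theorem stmt_12 {ι : Type*} [AddCommMonoid ι] [DecidableEq ι]
    {A B : Type*} [CommRing A] [CommRing B]
    (𝒜 : ι → AddSubgroup A) (ℬ : ι → AddSubgroup B)
    [GradedRing 𝒜] [GradedRing ℬ]
    (φ : A →+* B)
    (h_graded : ∀ i : ι, ∀ a ∈ 𝒜 i, φ a ∈ ℬ i)
    (h_int : φ.IsIntegral)
    (𝔭 : Ideal A) (h𝔭_hom : Ideal.IsHomogeneous 𝒜 𝔭) (h𝔭_ne : 𝔭 ≠ ⊤)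
    (h𝔭_prime : ∀ (i : ι) (x : A), x ∈ 𝒜 i → x ∉ 𝔭 → ∀ b : A, x * b ∈ 𝔭 → b ∈ 𝔭)
    (𝔮 : Ideal B) (h𝔮_hom : Ideal.IsHomogeneous ℬ 𝔮) (h𝔮_ne : 𝔮 ≠ ⊤)
    (h𝔮_prime : ∀ (i : ι) (y : B), y ∈ ℬ i → y ∉ 𝔮 → ∀ b : B, y * b ∈ 𝔮 → b ∈ 𝔮)
    (h_comap : Ideal.comap φ 𝔮 = 𝔭) :
    ∀ J : Ideal B, Ideal.IsHomogeneous ℬ J → 𝔮 < J → Ideal.comap φ J ≠ 𝔭 := by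
  intro J hJ hlt
  obtain ⟨i, y, hyi, hyJ, hyq⟩ := hJ.exists_homogeneous_mem_notMem hlt.not_ge
  obtain ⟨f, hf, hfy⟩ := h_int y
  rw [← h_comap]
  exact Ideal.comap_ne_comap_of_monic_eval₂_mem φ h𝔮_ne hlt.le hyJ (h𝔮_prime i y hyi hyq) hf
    (hfy ▸ 𝔮.zero_mem)
end

section
/- Let R be a commutative integral domain and let ϖ ∈ R be a nonzero non-unit. Let T = R[1/ϖ] be the localization of R away from ϖ, let R′ ⊆ T be the image of R, and equip T with the Tate topology in which the subgroups ϖ^m·R′ (m ∈ ℕ) form a neighborhood basis of 0. Assume T has no nonzero topological divisors of zero: there is no nonzero f ∈ T together with a sequence (g_n) in T and an m ∈ ℕ such that g_n ∉ ϖ^m·R′ for all n while g_n·f → 0 (meaning for every k ∈ ℕ, g_n·f ∈ ϖ^k·R′ for all sufficiently large n). Then for every prime ideal 𝔭 of R containing ϖ, the localization R_𝔭 is ϖ-adically separated: ⋂_{k ∈ ℕ} ϖ^k·R_𝔭 = 0. -/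
/-- Let `R` be a domain and `ϖ ∈ R` a nonzero non-unit.  Suppose that the Tate ring
`T = R[1/ϖ]` (with the topology generated by the subgroups `ϖ^m·R`) has no nonzero topological
divisors of zero.  Then, for every prime ideal `𝔭` of `R` containing `ϖ`, the localization `R_𝔭`
is `ϖ`-adically separated: `⋂_k ϖ^k·R_𝔭 = 0`. -/
theorem stmt_13 {R : Type*} [CommRing R] [IsDomain R] (ϖ : R)
    (hϖ_ne : ϖ ≠ 0) (hϖ_nu : ¬ IsUnit ϖ)
    (h_no_tdz : ¬ ∃ (f : Localization.Away ϖ) (g : ℕ → Localization.Away ϖ) (m : ℕ),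
      f ≠ 0 ∧
      (∀ n : ℕ, ¬ ∃ a : R, g n =
        algebraMap R (Localization.Away ϖ) ϖ ^ m * algebraMap R (Localization.Away ϖ) a) ∧
      (∀ k : ℕ, ∃ N : ℕ, ∀ n ≥ N, ∃ a : R, g n * f =
        algebraMap R (Localization.Away ϖ) ϖ ^ k * algebraMap R (Localization.Away ϖ) a)) :
    ∀ (𝔭 : Ideal R) [𝔭.IsPrime], ϖ ∈ 𝔭 →
      (⨅ k : ℕ, Ideal.span {algebraMap R (Localization.AtPrime 𝔭) ϖ ^ k}) = ⊥ := by
  intro 𝔭 _ hϖ𝔭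
  have hA : Function.Injective (algebraMap R (Localization.Away ϖ)) :=
    IsLocalization.injective _ (powers_le_nonZeroDivisors_of_noZeroDivisors hϖ_ne)
  have hP : Function.Injective (algebraMap R (Localization.AtPrime 𝔭)) :=
    IsLocalization.injective _ 𝔭.primeCompl_le_nonZeroDivisors
  rw [eq_bot_iff]
  intro x hx
  rw [Ideal.mem_bot]
  by_contra hx0
  obtain ⟨⟨f, s⟩, hfs⟩ := IsLocalization.surj 𝔭.primeCompl x
  have hs : algebraMap R (Localization.AtPrime 𝔭) s ≠ 0 :=
    (IsLocalization.map_units (Localization.AtPrime 𝔭) s).ne_zero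
  have hf : f ≠ 0 := by
    rintro rfl
    rw [map_zero] at hfs
    exact (mul_ne_zero hx0 hs) hfs
  have key : ∀ k : ℕ, ∃ t a : R, t ∉ 𝔭 ∧ t * f = ϖ ^ k * a := by
    intro k
    obtain ⟨y, rfl⟩ := Ideal.mem_span_singleton'.1 ((Submodule.mem_iInf _).1 hx k)
    obtain ⟨⟨a, t⟩, hat⟩ := IsLocalization.surj 𝔭.primeCompl y
    refine ⟨t, a * s, t.2, hP ?_⟩
    simp only [map_mul, map_pow] at hfs hat ⊢
    rw [← hfs, ← hat]
    ring
  choose t a ht hta using key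
  refine h_no_tdz ⟨algebraMap R _ f, fun n => algebraMap R _ (t n), 1, ?_, ?_, ?_⟩
  · exact (map_ne_zero_iff _ hA).2 hf
  · rintro n ⟨b, hb⟩
    rw [pow_one, ← map_mul] at hb
    exact ht n (hA hb ▸ 𝔭.mul_mem_right b hϖ𝔭)
  · refine fun k => ⟨k, fun n hn => ⟨ϖ ^ (n - k) * a n, ?_⟩⟩
    rw [← map_mul, ← map_pow, ← map_mul, hta, ← mul_assoc, ← pow_add, Nat.add_sub_cancel' hn]
end

section
/- Let p be a prime and let R be a commutative integral domain of characteristic p, with perfect closure R^{coperf} (into which R embeds canonically). Let ‖·‖ be a power-multiplicative nonarchimedean ring norm on R^{coperf}. Then ‖·‖ is topologically simple on R^{coperf} (every nonzero ideal of R^{coperf} is dense with respect to ‖·‖) if and only if its restriction to R is topologically simple (every nonzero ideal J of R is dense in R: for every g ∈ R and ε > 0 there is h ∈ J with ‖g − h‖ < ε, where g, h are viewed in R^{coperf}). -/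
theorem PerfectClosure.mk_pow_prime_pow {R : Type*} [CommRing R] (p : ℕ) [Fact p.Prime]
    [CharP R p] (n : ℕ) (c : R) :
    PerfectClosure.mk R p (n, c) ^ p ^ n = PerfectClosure.of R p c := by
  rw [← iterate_frobenius, PerfectClosure.iterate_frobenius_mk, PerfectClosure.of_apply]

theorem PerfectClosure.exists_pow_eq_of {R : Type*} [CommRing R] (p : ℕ) [Fact p.Prime]
    [CharP R p] (a : PerfectClosure R p) :
    ∃ (n : ℕ) (c : R), a ^ p ^ n = PerfectClosure.of R p c := by
  obtain ⟨⟨n, c⟩, rfl⟩ := PerfectClosure.mk_surjective R p a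
  exact ⟨n, c, PerfectClosure.mk_pow_prime_pow p n c⟩

/-- Let `R` be a commutative integral domain of characteristic `p` (a prime), with
perfect closure `PerfectClosure R p`, and let `nrm` be a power-multiplicative nonarchimedean ring
norm on the perfect closure.  Then `nrm` is topologically simple on the perfect closure (every
nonzero ideal is dense) if and only if its restriction to `R` is topologically simple (every
nonzero ideal of `R` is dense in `R`). -/
theorem stmt_14 {R : Type*} [CommRing R] [IsDomain R] (p : ℕ) [Fact p.Prime] [CharP R p]
    (nrm : PerfectClosure R p → ℝ)
    (h_nonneg : ∀ a, 0 ≤ nrm a) (h_zero : nrm 0 = 0) (h_one : nrm 1 = 1)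
    (h_add : ∀ a b, nrm (a + b) ≤ max (nrm a) (nrm b))
    (h_mul : ∀ a b, nrm (a * b) ≤ nrm a * nrm b)
    (h_def : ∀ a, nrm a = 0 → a = 0)
    (h_pm : ∀ (a : PerfectClosure R p) (n : ℕ), 1 ≤ n → nrm (a ^ n) = nrm a ^ n) :
    (∀ I : Ideal (PerfectClosure R p), I ≠ ⊥ →
      ∀ g : PerfectClosure R p, ∀ ε > (0 : ℝ), ∃ h ∈ I, nrm (g - h) < ε) ↔
    (∀ J : Ideal R, J ≠ ⊥ → ∀ g : R, ∀ ε > (0 : ℝ), ∃ h ∈ J,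
      nrm (PerfectClosure.of R p g - PerfectClosure.of R p h) < ε) := by
  have hp : p.Prime := Fact.out
  have hpos (n : ℕ) : 1 ≤ p ^ n := Nat.one_le_pow _ _ hp.pos
  have hinj : Function.Injective (PerfectClosure.of R p) := by
    intro x y hxy
    rw [PerfectClosure.of_apply, PerfectClosure.of_apply, PerfectClosure.eq_iff] at hxy
    simpa using hxy
  constructor
  · intro H J hJ g ε hε
    obtain ⟨y, hyJ, hy0⟩ := Submodule.exists_mem_ne_zero_of_ne_bot hJ
    have hI : Ideal.span {PerfectClosure.of R p y} ≠ ⊥ := by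
      rw [Ne, Ideal.span_singleton_eq_bot]
      exact (map_ne_zero_iff _ hinj).2 hy0
    set G := nrm (PerfectClosure.of R p g)
    have hG0 : 0 ≤ G := h_nonneg _
    set δ := min 1 (ε / (G + 1))
    have hδ0 : 0 < δ := lt_min one_pos (by positivity)
    obtain ⟨h, hhI, hh⟩ := H _ hI 1 δ hδ0
    obtain ⟨a, rfl⟩ := Ideal.mem_span_singleton'.1 hhI
    obtain ⟨n, c, hc⟩ := PerfectClosure.exists_pow_eq_of p a
    refine ⟨g * (c * y ^ p ^ n), J.mul_mem_left _ (J.mul_mem_left _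
      (J.pow_mem_of_mem hyJ _ (hpos n))), ?_⟩
    have key : PerfectClosure.of R p g - PerfectClosure.of R p (g * (c * y ^ p ^ n)) =
        (1 - a * PerfectClosure.of R p y) ^ p ^ n * PerfectClosure.of R p g := by
      rw [sub_pow_char_pow, one_pow, mul_pow, hc, map_mul, map_mul, map_pow]
      ring
    have hδn : nrm ((1 - a * PerfectClosure.of R p y) ^ p ^ n) ≤ δ := by
      rw [h_pm _ _ (hpos n)]
      exact (pow_le_of_le_one (h_nonneg _) (hh.le.trans (min_le_left _ _))
        (Nat.one_le_iff_ne_zero.1 (hpos n))).trans hh.le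
    calc _ ≤ nrm ((1 - a * PerfectClosure.of R p y) ^ p ^ n) * G := key ▸ h_mul _ _
      _ ≤ δ * G := mul_le_mul_of_nonneg_right hδn hG0
      _ < δ * (G + 1) := mul_lt_mul_of_pos_left (lt_add_one G) hδ0
      _ ≤ ε / (G + 1) * (G + 1) :=
        mul_le_mul_of_nonneg_right (min_le_right _ _) (by positivity)
      _ = ε := div_mul_cancel₀ _ (by positivity)
  · intro H I hI g ε hε
    obtain ⟨f, hfI, hf0⟩ := Submodule.exists_mem_ne_zero_of_ne_bot hI
    obtain ⟨n, y, hy⟩ := PerfectClosure.exists_pow_eq_of p f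
    obtain ⟨m, x, hx⟩ := PerfectClosure.exists_pow_eq_of p g
    have hy0 : y ≠ 0 := by
      rintro rfl
      rw [map_zero] at hy
      exact hf0 (h_def f (eq_zero_of_pow_eq_zero (n := p ^ n)
        (by rw [← h_pm _ _ (hpos n), hy, h_zero])))
    have hyI : PerfectClosure.of R p y ∈ I := hy ▸ I.pow_mem_of_mem hfI _ (hpos n)
    have hJ : Ideal.span {y ^ p ^ m} ≠ ⊥ := by
      rw [Ne, Ideal.span_singleton_eq_bot]
      exact pow_ne_zero _ hy0
    obtain ⟨h, hhJ, hh⟩ := H _ hJ x (ε ^ p ^ m) (by positivity)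
    obtain ⟨c, rfl⟩ := Ideal.mem_span_singleton'.1 hhJ
    refine ⟨PerfectClosure.mk R p (m, c) * PerfectClosure.of R p y, I.mul_mem_left _ hyI, ?_⟩
    refine lt_of_pow_lt_pow_left₀ (p ^ m) hε.le ?_
    rw [← h_pm _ _ (hpos m), sub_pow_char_pow, mul_pow,
      PerfectClosure.mk_pow_prime_pow, hx, ← map_pow, ← map_mul]
    exact hh
end

section
/- Let A be a commutative ring with a multiplicative nonarchimedean norm v that is topologically simple (every nonzero ideal of A is dense with respect to v). Let B be a commutative ring with a multiplicative nonarchimedean norm w, and let φ : A → B be a ring homomorphism with w(φ(a)) = v(a) for all a ∈ A. Suppose there is a multiplicatively closed subset S of A (containing 1) such that φ(s) is a unit of B for every s ∈ S, and such that the image of the localization S⁻¹A, namely the set {x ∈ B | x·φ(s) = φ(a) for some a ∈ A and s ∈ S}, is dense in B with respect to w. Then w is topologically simple: every nonzero ideal of B is dense with respect to w. -/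
/-- Let `(A, v)` be a commutative ring with a topologically simple multiplicative
nonarchimedean norm, `(B, w)` a commutative ring with a multiplicative nonarchimedean norm, and
`φ : A → B` an isometric ring homomorphism.  If there is a multiplicatively closed subset `S` of
`A` mapping to units of `B` such that the image of the localization `S⁻¹A` is dense in `B`, then
`w` is topologically simple as well. -/
theorem stmt_15 {A B : Type*} [CommRing A] [CommRing B]
    (v : A → ℝ) (w : B → ℝ)
    (hv_nonneg : ∀ a, 0 ≤ v a) (hv_zero : v 0 = 0) (hv_one : v 1 = 1)
    (hv_add : ∀ a b, v (a + b) ≤ max (v a) (v b))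
    (hv_mul : ∀ a b, v (a * b) = v a * v b)
    (hv_def : ∀ a, v a = 0 → a = 0)
    (hw_nonneg : ∀ b, 0 ≤ w b) (hw_zero : w 0 = 0) (hw_one : w 1 = 1)
    (hw_add : ∀ b c, w (b + c) ≤ max (w b) (w c))
    (hw_mul : ∀ b c, w (b * c) = w b * w c)
    (hw_def : ∀ b, w b = 0 → b = 0)
    (h_simple : ∀ I : Ideal A, I ≠ ⊥ → ∀ g : A, ∀ ε > (0 : ℝ), ∃ h ∈ I, v (g - h) < ε)
    (φ : A →+* B) (h_iso : ∀ a, w (φ a) = v a)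
    (S : Submonoid A) (hS : ∀ s ∈ S, IsUnit (φ s))
    (h_dense : ∀ b : B, ∀ ε > (0 : ℝ), ∃ x : B,
      (∃ a : A, ∃ s ∈ S, x * φ s = φ a) ∧ w (b - x) < ε) :
    ∀ I : Ideal B, I ≠ ⊥ → ∀ g : B, ∀ ε > (0 : ℝ), ∃ h ∈ I, w (g - h) < ε := by
  intro I hI g ε hε
  obtain ⟨b, hbI, hb⟩ := Submodule.exists_mem_ne_zero_of_ne_bot hI
  have hw_neg_one : w (-1) = 1 := by
    have h : w (-1) * w (-1) = 1 := by rw [← hw_mul]; simpa using hw_one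
    nlinarith [hw_nonneg (-1)]
  have hw_neg (y : B) : w (-y) = w y := by
    rw [← neg_one_mul, hw_mul, hw_neg_one, one_mul]
  have hwb : 0 < w b := (hw_nonneg b).lt_of_ne fun h => hb (hw_def b h.symm)
  have hwg : 0 < w g + 1 := by linarith [hw_nonneg g]
  obtain ⟨δ, hδ, hδ1, hδε⟩ : ∃ δ : ℝ, 0 < δ ∧ δ < 1 ∧ w g * δ < ε := by
    refine ⟨min (1 / 2) (ε / (w g + 1)), by positivity,
      (min_le_left _ _).trans_lt (by norm_num), ?_⟩
    calc w g * min (1 / 2) (ε / (w g + 1)) ≤ w g * (ε / (w g + 1)) :=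
          mul_le_mul_of_nonneg_left (min_le_right _ _) (hw_nonneg g)
      _ < (w g + 1) * (ε / (w g + 1)) :=
          mul_lt_mul_of_pos_right (lt_add_one _) (by positivity)
      _ = ε := mul_div_cancel₀ _ hwg.ne'
  obtain ⟨x, ⟨a, s, hs, hxs⟩, hbx⟩ := h_dense b (δ * w b) (by positivity)
  have hwx : w b ≤ w x := by
    have h := hw_add (b - x) x
    rw [sub_add_cancel] at h
    rcases le_max_iff.mp h with h | h
    · nlinarith
    · exact h
  have ha : a ≠ 0 := by
    rintro rfl
    rw [map_zero, (hS s hs).mul_left_eq_zero] at hxs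
    rw [hxs, hw_zero] at hwx
    linarith
  -- Approximating `1` by `c * a` forces `w (φ c * φ s) = (w x)⁻¹`, bounding the error in `b`.
  obtain ⟨_, hmem, hca⟩ := h_simple (Ideal.span {a})
    (by rwa [Ne, Ideal.span_singleton_eq_bot]) 1 δ hδ
  obtain ⟨c, rfl⟩ := Ideal.mem_span_singleton'.mp hmem
  have hcx : φ c * φ s * x = φ (c * a) := by rw [map_mul, ← hxs]; ring
  have h1 : w (1 - φ c * φ s * x) < δ := by
    rw [hcx, ← map_one φ, ← map_sub, h_iso]
    exact hca
  have h2 : w (φ c * φ s) * w x ≤ 1 := by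
    rw [← hw_mul]
    have h := hw_add 1 (-(1 - φ c * φ s * x))
    rw [hw_neg, hw_one, max_eq_left (h1.trans hδ1).le] at h
    simpa using h
  have h3 : w (φ c * φ s * (b - x)) ≤ δ := by
    rw [hw_mul]
    calc w (φ c * φ s) * w (b - x) ≤ w (φ c * φ s) * (δ * w x) :=
          mul_le_mul_of_nonneg_left
            (hbx.le.trans (mul_le_mul_of_nonneg_left hwx hδ.le)) (hw_nonneg _)
      _ = δ * (w (φ c * φ s) * w x) := by ring
      _ ≤ δ := mul_le_of_le_one_right hδ.le h2
  have h4 : w (1 - φ c * φ s * b) ≤ δ := by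
    have h := hw_add (1 - φ c * φ s * x) (-(φ c * φ s * (b - x)))
    rw [hw_neg] at h
    rw [show 1 - φ c * φ s * b
      = 1 - φ c * φ s * x + -(φ c * φ s * (b - x)) by ring]
    exact h.trans (max_le h1.le h3)
  refine ⟨g * (φ c * φ s) * b, I.mul_mem_left _ hbI, ?_⟩
  rw [show g - g * (φ c * φ s) * b = g * (1 - φ c * φ s * b) by ring, hw_mul]
  exact (mul_le_mul_of_nonneg_left h4 (hw_nonneg g)).trans_lt hδε
end

section
/- Let R be a commutative ring, Γ a linearly ordered commutative group with zero, and v : R → Γ a nontrivial valuation (v(x) ∉ {0, 1} for some x) with trivial support (v(x) = 0 if and only if x = 0), so that R is an integral domain. Let ϖ be a unit of R with 0 < v(ϖ) < 1, let A = R_{v≤1} = {x ∈ R | v(x) ≤ 1} be the unit ball subring, and assume R = A[1/ϖ], i.e. for every f ∈ R there is n ∈ ℕ with v(ϖ^n·f) ≤ 1. Then the following are equivalent: (a) R is topologically simple for the ϖ-adic Tate topology, i.e. for every ideal I of R, either v(f) ≤ v(ϖ)^n for all f ∈ I and all n ∈ ℕ, or for every g ∈ R and every n ∈ ℕ there is h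 ∈ I with v(g − h) ≤ v(ϖ)^n; (b) A is ϖ-valuative: every finitely generated ideal I of A that contains some power ϖ^k is invertible, meaning there exists an A-submodule J of R with I·J = A (product taken as A-submodules of R). (By results of Knebusch–Zhang and Fujiwara–Kato, condition (b) is equivalent to v being a Prüfer–Manis valuation, so this is the statement that v is Prüfer–Manis if and only if it is topologically simple.) -/
theorem Valuation.mem_one_submodule_integer_iff {R Γ : Type*} [CommRing R]
    [LinearOrderedCommGroupWithZero Γ] (v : Valuation R Γ) (x : R) :
    x ∈ (1 : Submodule v.integer R) ↔ v x ≤ 1 := by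
  rw [Submodule.mem_one]
  exact ⟨fun ⟨y, hy⟩ => hy ▸ y.2, fun h => ⟨⟨x, h⟩, rfl⟩⟩

/-- A finitely generated ideal of the unit ball has an element of maximal value. -/
theorem Valuation.exists_max_of_fg {R Γ : Type*} [CommRing R]
    [LinearOrderedCommGroupWithZero Γ] (v : Valuation R Γ) {I : Ideal v.integer} (hI : I.FG) :
    ∃ f ∈ I, ∀ x ∈ I, v (x : R) ≤ v (f : R) := by
  classical
  obtain ⟨S, rfl⟩ := hI
  obtain ⟨f, hf, hmax⟩ := (insert 0 S).exists_max_image (fun x : v.integer => v (x : R))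
    (Finset.insert_nonempty 0 S)
  refine ⟨f, ?_, fun x hx => ?_⟩
  · rcases Finset.mem_insert.1 hf with rfl | hf
    · exact zero_mem _
    · exact Submodule.subset_span hf
  · induction hx using Submodule.span_induction with
    | mem x hx => exact hmax x (Finset.mem_insert_of_mem hx)
    | zero => simp
    | add x y _ _ hx hy => exact v.map_add_le hx hy
    | smul a x _ hx =>
      calc v ((a • x : v.integer) : R) = v (a : R) * v (x : R) := by simp
        _ ≤ v (x : R) := mul_le_of_le_one_left' a.2
        _ ≤ v (f : R) := hx

/-- If an ideal of the unit ball has an element `f` of maximal value and contains `p`, and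
`1 - f * a = p * b` with `v (f * a) = 1` and `v b ≤ 1`, then it is invertible. -/
theorem Valuation.exists_mul_eq_one_of_max {R Γ : Type*} [CommRing R]
    [LinearOrderedCommGroupWithZero Γ] (v : Valuation R Γ) {I : Ideal v.integer}
    {f p : v.integer} (hf : f ∈ I) (hmax : ∀ x ∈ I, v (x : R) ≤ v (f : R)) (hp : p ∈ I)
    {a b : R} (hab : 1 - (f : R) * a = p * b) (ha : v ((f : R) * a) = 1) (hb : v b ≤ 1) :
    ∃ J : Submodule v.integer R,
      Submodule.map (Algebra.linearMap v.integer R) I * J = 1 := by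
  set M := Submodule.map (Algebra.linearMap v.integer R) I
  have hmem : ∀ c : R, (∀ x ∈ I, v (c * x) ≤ 1) → c ∈ (1 / M) := by
    intro c hc
    rw [Submodule.mem_div_iff_forall_mul_mem]
    rintro _ ⟨x, hx, rfl⟩
    exact (v.mem_one_submodule_integer_iff _).2 (hc x hx)
  refine ⟨1 / M, le_antisymm Submodule.mul_one_div_le_one ?_⟩
  rw [Submodule.one_le]
  have hone : (1 : R) = f * a + p * b := by rw [← hab]; ring
  rw [hone]
  refine add_mem (Submodule.mul_mem_mul ⟨f, hf, rfl⟩ (hmem a fun x hx => ?_))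
    (Submodule.mul_mem_mul ⟨p, hp, rfl⟩ (hmem b fun x _ => ?_))
  · rw [map_mul, ← ha, map_mul, mul_comm]
    gcongr
    exact hmax x hx
  · rw [map_mul]
    exact mul_le_one' hb x.2

/-- If the ideal of the unit ball generated by `f` and `p` is invertible, then `1` is a
combination of `f` and `p` whose coefficients multiply `f` into the unit ball. -/
theorem Valuation.exists_add_eq_one_of_mul_eq_one {R Γ : Type*} [CommRing R]
    [LinearOrderedCommGroupWithZero Γ] (v : Valuation R Γ) {f p : v.integer}
    {J : Submodule v.integer R}
    (hJ : Submodule.map (Algebra.linearMap v.integer R) (Ideal.span {f, p}) * J = 1) :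
    ∃ a b : R, (f : R) * a + p * b = 1 ∧ v ((f : R) * b) ≤ 1 := by
  have h1 : (1 : R) ∈ (1 : Submodule v.integer R) := Submodule.one_le.1 le_rfl
  rw [← hJ, Ideal.span, Submodule.map_span, Set.image_pair, Submodule.span_insert,
    Submodule.sup_mul, Submodule.mem_sup] at h1
  obtain ⟨y, hy, z, hz, hyz⟩ := h1
  obtain ⟨a, -, rfl⟩ := Submodule.mem_span_singleton_mul.1 hy
  obtain ⟨b, hb, rfl⟩ := Submodule.mem_span_singleton_mul.1 hz
  refine ⟨a, b, hyz, ?_⟩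
  rw [← v.mem_one_submodule_integer_iff, ← hJ]
  exact Submodule.mul_mem_mul ⟨f, Ideal.subset_span (by simp), rfl⟩ hb

/-- topologically simple = Prüfer–Manis: Let `v` be a nontrivial valuation with
trivial support on a commutative ring `R` (so `R` is a domain), let `ϖ` be a unit of `R` with
`0 < v(ϖ) < 1`, and assume `R = A[1/ϖ]` where `A = R_{v ≤ 1}` is the unit ball.  Then `R` is
topologically simple for the `ϖ`-adic Tate topology if and only if `A` is `ϖ`-valuative: every
finitely generated ideal of `A` containing a power of `ϖ` is invertible as an `A`-submodule of
`R` (by Knebusch–Zhang and Fujiwara–Kato, this says exactly that `v` is Prüfer–Manis). -/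
theorem stmt_17 {R Γ : Type*} [CommRing R] [LinearOrderedCommGroupWithZero Γ]
    (v : Valuation R Γ)
    (h_supp : ∀ x : R, v x = 0 ↔ x = 0)
    (h_nontriv : ∃ x : R, v x ≠ 0 ∧ v x ≠ 1)
    (ϖ : R) (hϖ_unit : IsUnit ϖ) (hϖ_pos : 0 < v ϖ) (hϖ_lt : v ϖ < 1)
    (hϖ_gen : ∀ f : R, ∃ n : ℕ, v (ϖ ^ n * f) ≤ 1) :
    (∀ I : Ideal R,
        (∀ f ∈ I, ∀ n : ℕ, v f ≤ v ϖ ^ n) ∨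
        (∀ g : R, ∀ n : ℕ, ∃ h ∈ I, v (g - h) ≤ v ϖ ^ n)) ↔
    (∀ I : Ideal v.integer, I.FG →
      (∃ (k : ℕ) (x : v.integer), (x : R) = ϖ ^ k ∧ x ∈ I) →
      ∃ J : Submodule v.integer R,
        Submodule.map (Algebra.linearMap v.integer R) I * J = 1) := by
  have hlt1 : ∀ n : ℕ, v ϖ ^ n ≤ 1 := fun n => pow_le_one' hϖ_lt.le n
  constructor
  · rintro hsimple I hI ⟨k, p, hp, hpI⟩
    obtain ⟨f, hf, hmax⟩ := v.exists_max_of_fg hI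
    have hkf : v ϖ ^ k ≤ v (f : R) := by simpa [hp] using hmax p hpI
    have hdecr : v ϖ ^ (k + 1) < v ϖ ^ k := pow_lt_pow_right_of_lt_one₀ hϖ_pos hϖ_lt k.lt_succ_self
    rcases hsimple (Ideal.span {(f : R)}) with h | h
    · exact absurd (h f (Ideal.mem_span_singleton_self _) (k + 1)) (hdecr.trans_le hkf).not_ge
    obtain ⟨y, hy, hv⟩ := h 1 (k + 1)
    obtain ⟨a, rfl⟩ := Ideal.mem_span_singleton.1 hy
    obtain ⟨b, hb⟩ := (hϖ_unit.pow k).dvd (a := 1 - (f : R) * a)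
    refine v.exists_mul_eq_one_of_max hf hmax hpI (hp ▸ hb) ?_ ?_
    · have : v ((1 : R) - f * a) < v 1 := by
        rw [map_one]
        exact hv.trans_lt (hdecr.trans_le (hlt1 k))
      simpa using v.map_sub_eq_of_lt_left this
    · rw [hb, map_mul, map_pow] at hv
      have hle := hv.trans hdecr.le
      exact (mul_le_iff_le_one_right (pow_pos hϖ_pos k)).1 hle
  · intro hinv I
    refine or_iff_not_imp_left.2 fun hI g n => ?_
    push Not at hI
    obtain ⟨f₀, hf₀, m, hm⟩ := hI
    obtain ⟨l, hl⟩ := hϖ_gen f₀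
    obtain ⟨r, hr⟩ := hϖ_gen g
    let f : v.integer := ⟨ϖ ^ l * f₀, hl⟩
    let p : v.integer := ⟨ϖ ^ (n + r + (l + m)), by
      rw [Valuation.mem_integer_iff, map_pow]; exact hlt1 _⟩
    obtain ⟨J, hJ⟩ := hinv (Ideal.span {f, p}) (Submodule.fg_span (Set.toFinite _))
      ⟨n + r + (l + m), p, rfl, Ideal.subset_span (by simp)⟩
    obtain ⟨a, b, hab, hb⟩ := v.exists_add_eq_one_of_mul_eq_one hJ
    refine ⟨g * (f * a), I.mul_mem_left _ (I.mul_mem_right _ (I.mul_mem_left _ hf₀)), ?_⟩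
    have hsmall : v (ϖ ^ (l + m) * b) ≤ 1 := by
      refine le_trans ?_ hb
      simp only [f, map_mul, map_pow, pow_add]
      gcongr
    have hsub : g - g * (f * a) = ϖ ^ n * ((ϖ ^ r * g) * (ϖ ^ (l + m) * b)) := by
      calc g - g * (f * a) = g * (f * a + p * b) - g * (f * a) := by rw [hab, mul_one]
        _ = _ := by simp only [p]; ring
    rw [hsub, map_mul, map_pow, map_mul]
    exact mul_le_of_le_one_right' (mul_le_one' hr hsmall)
end
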